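/- Let (H, α, β, ·, Δ, ε) be a Hopf algebroid over R and F a twistor of H. Let W_{H_F} := ⊕_{n≥0} H^{⊗_{R_F} n}[−n] with product x ∪ y := (−1)^{|x||y|} x⊗_{R_F} y, and let W_H := ⊕_{n≥0} H^{⊗_R n}[−n] with the twisted product x ∪_F y := (−1)^{|x|} F{x, y}, where F{x, y} is the operadic brace of P_H applied to F ∈ P_H(2). Then: (i) (W_H, ∪_F) is a graded associative algebra with unit 1; (ii) the assignment x₁ ∪ ⋯ ∪ x_n ↦ x₁ ∪_F ⋯ ∪_F x_n (all x_i ∈ H) descends to a well-defined K-linear map F♯ : W_{H_F} → W_H, and F♯ is a morphism of graded associative algebras: F♯(y ∪ y') = F♯(y) ∪_F F♯(y') for all y, y' ∈ W_{H_F}. -/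

import Mathlib

/-! # Preliminaries: Hopf algebroids in the sense of Xu

We fix a field `K` of characteristic zero, an associative unital `K`-algebra `R` and an
associative unital `K`-algebra `H`.  We construct the `n`-fold tensor powers
`H^{⊗_K n}` of `H` over `K` and, given source and target maps `α, β : R → H`, the
quotients `H^{⊗_R n}` of `H^{⊗_K n}` by the right ideal `I_n` generated by the elements
`1 ⊗ ⋯ ⊗ β(r) ⊗ 1 ⊗ ⋯ ⊗ 1 − 1 ⊗ ⋯ ⊗ 1 ⊗ α(r) ⊗ ⋯ ⊗ 1`.

A Hopf algebroid is then given by the data `(H, α, β, ·, Δ, ε)` subject to the axioms of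
Xu; the iterated coproducts `Δⁿ = (Δ^{n−1} ⊗_R id) ∘ Δ` are part of the data, uniquely
characterized by their recursion.  All axioms involving maps induced on the quotients
`H^{⊗_R n}` are stated equivalently in terms of (arbitrary) lifts along the quotient
maps and (arbitrary) presentations of elements as sums of pure tensors. -/

noncomputable section

open scoped TensorProduct

universe u

variable (K : Type u) [Field K] [CharZero K]

/-- A bundled associative unital `K`-algebra. -/
structure BAlg : Type (u + 1) where
  carrier : Type u
  [isRing : Ring carrier]
  [isAlgebra : Algebra K carrier]

attribute [instance] BAlg.isRing BAlg.isAlgebra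

instance : CoeSort (BAlg K) (Type u) := ⟨BAlg.carrier⟩

variable (H : Type u) [Ring H] [Algebra K H]

/-- The `n`-fold tensor power `H^{⊗_K n}` of `H` over `K` (with `H^{⊗_K 0} = K` and
`H^{⊗_K 1} = H`), as a bundled `K`-algebra. -/
def TPa : ℕ → BAlg K
  | 0 => ⟨K⟩
  | 1 => ⟨H⟩
  | (n + 2) => ⟨(TPa (n + 1)) ⊗[K] H⟩

/-- The `n`-fold tensor power `H^{⊗_K n}`. -/
abbrev TP (n : ℕ) : Type u := TPa K H n

/-- The element of `H^{⊗_K n}` with `h` in slot `i` (`0`-indexed) and `1` in all other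
slots. -/
def slotP : (n : ℕ) → ℕ → H → TP K H n
  | 0, _, _ => 1
  | 1, _, h => h
  | (n + 2), i, h =>
      if i = n + 1 then ((1 : TP K H (n + 1)) ⊗ₜ[K] h : TP K H (n + 1) ⊗[K] H)
      else ((slotP (n + 1) i h) ⊗ₜ[K] (1 : H) : TP K H (n + 1) ⊗[K] H)

/-- The pure tensor `x₀ ⊗ x₁ ⊗ ⋯ ⊗ x_{n-1} ∈ H^{⊗_K n}`, written as the product of its
slot components. -/
def chainP (n : ℕ) (x : Fin n → H) : TP K H n :=
  (List.ofFn (fun i : Fin n => slotP K H n (i : ℕ) (x i))).prod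

variable {R : Type u} [Ring R] [Algebra K R]

/-- The relator `1 ⊗ ⋯ ⊗ β(r) ⊗ 1 ⊗ ⋯ ⊗ 1 − 1 ⊗ ⋯ ⊗ 1 ⊗ α(r) ⊗ ⋯ ⊗ 1` with `β(r)` in
slot `i` and `α(r)` in slot `i + 1` (`0`-indexed). -/
def relator (αf βf : R → H) (n : ℕ) (r : R) (i : ℕ) : TP K H n :=
  slotP K H n i (βf r) - slotP K H n (i + 1) (αf r)

/-- The right ideal `I_n ⊆ H^{⊗_K n}` generated by the relators. -/
def Idl (αf βf : R → H) (n : ℕ) : Submodule K (TP K H n) :=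
  Submodule.span K
    {z | ∃ (r : R) (i : ℕ) (x : TP K H n), i + 2 ≤ n ∧ z = relator K H αf βf n r i * x}

/-- The `n`-fold tensor power `H^{⊗_R n} := H^{⊗_K n} / I_n` of `H` over `R`
(`H^{⊗_R 1} = H` and, by convention, `H^{⊗_R 0} = R` is treated separately). -/
abbrev QT (αf βf : R → H) (n : ℕ) : Type u := TP K H n ⧸ Idl K H αf βf n

/-- The quotient map `H^{⊗_K n} → H^{⊗_R n}`. -/
abbrev qtMk (αf βf : R → H) (n : ℕ) : TP K H n →ₗ[K] QT K H αf βf n :=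
  (Idl K H αf βf n).mkQ

variable (R)

/-- A Hopf algebroid `(H, α, β, ·, Δ, ε)` over `R`, in the sense of Xu, together with its
(uniquely characterized) iterated coproducts `Δⁿ`.  The source map `α` (an algebra
homomorphism) and the target map `β` (an algebra anti-homomorphism) are taken as
parameters.  All conditions on elements of the quotients `H^{⊗_R n}` are expressed via
arbitrary lifts along the quotient maps. -/
structure HopfAlgebroid (α : R →ₐ[K] H) (β : R →ₗ[K] H) : Type u where
  β_one : β 1 = 1
  /-- `β` is an algebra anti-homomorphism -/
  β_mul : ∀ a b : R, β (a * b) = β b * β a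
  /-- the images of `α` and `β` commute -/
  αβ_comm : ∀ a b : R, α a * β b = β b * α a
  /-- the coproduct -/
  Δ : H →ₗ[K] QT K H (fun a => α a) (fun a => β a) 2
  Δ_one : Δ 1 = qtMk K H (fun a => α a) (fun a => β a) 2 1
  /-- `Δ(x) · (β(a) ⊗ 1 − 1 ⊗ α(a)) = 0` -/
  Δ_compat : ∀ (x : H) (a : R) (s : TP K H 2),
    qtMk K H (fun a => α a) (fun a => β a) 2 s = Δ x →
    qtMk K H (fun a => α a) (fun a => β a) 2
      (s * relator K H (fun a => α a) (fun a => β a) 2 a 0) = 0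
  /-- `Δ(x₁ x₂) = Δ(x₁) · Δ(x₂)` -/
  Δ_mul : ∀ (x y : H) (s t : TP K H 2),
    qtMk K H (fun a => α a) (fun a => β a) 2 s = Δ x →
    qtMk K H (fun a => α a) (fun a => β a) 2 t = Δ y →
    Δ (x * y) = qtMk K H (fun a => α a) (fun a => β a) 2 (s * t)
  /-- `Δ` is a morphism of `(R,R)`-bimodules, left action -/
  Δ_bimod_left : ∀ (a : R) (x : H) (s : TP K H 2),
    qtMk K H (fun a => α a) (fun a => β a) 2 s = Δ x →
    Δ (α a * x) = qtMk K H (fun a => α a) (fun a => β a) 2 (slotP K H 2 0 (α a) * s)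
  /-- `Δ` is a morphism of `(R,R)`-bimodules, right action -/
  Δ_bimod_right : ∀ (a : R) (x : H) (s : TP K H 2),
    qtMk K H (fun a => α a) (fun a => β a) 2 s = Δ x →
    Δ (β a * x) = qtMk K H (fun a => α a) (fun a => β a) 2 (slotP K H 2 1 (β a) * s)
  /-- coassociativity `(Δ ⊗_R id) ∘ Δ = (id ⊗_R Δ) ∘ Δ` -/
  coassoc : ∀ (x : H) (C : ℕ) (uu vv : Fin C → H),
    qtMk K H (fun a => α a) (fun a => β a) 2 (∑ c, (uu c ⊗ₜ[K] vv c : TP K H 2)) = Δ x →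
    ∀ s t : Fin C → TP K H 2,
      (∀ c, qtMk K H (fun a => α a) (fun a => β a) 2 (s c) = Δ (uu c)) →
      (∀ c, qtMk K H (fun a => α a) (fun a => β a) 2 (t c) = Δ (vv c)) →
      qtMk K H (fun a => α a) (fun a => β a) 3 (∑ c, (s c ⊗ₜ[K] vv c : TP K H 3)) =
        qtMk K H (fun a => α a) (fun a => β a) 3
          (∑ c, (TensorProduct.assoc K H H H).symm (uu c ⊗ₜ[K] t c))
  /-- the counit -/
  ε : H →ₗ[K] R
  ε_one : ε 1 = 1
  ε_bimod_left : ∀ (a : R) (x : H), ε (α a * x) = a * ε x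
  ε_bimod_right : ∀ (a : R) (x : H), ε (β a * x) = ε x * a
  /-- `(ε ⊗_R id) ∘ Δ = id` -/
  counit_left : ∀ (x : H) (C : ℕ) (uu vv : Fin C → H),
    qtMk K H (fun a => α a) (fun a => β a) 2 (∑ c, (uu c ⊗ₜ[K] vv c : TP K H 2)) = Δ x →
    ∑ c, α (ε (uu c)) * vv c = x
  /-- `(id ⊗_R ε) ∘ Δ = id` -/
  counit_right : ∀ (x : H) (C : ℕ) (uu vv : Fin C → H),
    qtMk K H (fun a => α a) (fun a => β a) 2 (∑ c, (uu c ⊗ₜ[K] vv c : TP K H 2)) = Δ x →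
    ∑ c, β (ε (vv c)) * uu c = x
  /-- `ker ε` is a left ideal of `H` -/
  ker_ε_ideal : ∀ x y : H, ε y = 0 → ε (x * y) = 0
  /-- the iterated coproducts `Δⁿ : H → H^{⊗_R (n+1)}` -/
  Δpow : ∀ n : ℕ, H →ₗ[K] QT K H (fun a => α a) (fun a => β a) (n + 1)
  Δpow_zero : ∀ x : H, Δpow 0 x = qtMk K H (fun a => α a) (fun a => β a) 1 x
  Δpow_one : Δpow 1 = Δ
  /-- `Δ^{n+1} = (Δⁿ ⊗_R id) ∘ Δ` -/
  Δpow_succ : ∀ (n : ℕ) (x : H) (C : ℕ) (uu vv : Fin C → H),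
    qtMk K H (fun a => α a) (fun a => β a) 2 (∑ c, (uu c ⊗ₜ[K] vv c : TP K H 2)) = Δ x →
    ∀ s : Fin C → TP K H (n + 1),
      (∀ c, qtMk K H (fun a => α a) (fun a => β a) (n + 1) (s c) = Δpow n (uu c)) →
      Δpow (n + 1) x =
        qtMk K H (fun a => α a) (fun a => β a) (n + 2)
          (∑ c, (s c ⊗ₜ[K] vv c : TP K H (n + 2)))

namespace HopfAlgebroid

variable {K H R}
variable {α : R →ₐ[K] H} {β : R →ₗ[K] H} (D : HopfAlgebroid K H R α β)

/-- The left `H`-module structure `h ▷ a := ε(h · α(a))` on `R`. -/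
def hAct (h : H) (a : R) : R := D.ε (h * α a)

end HopfAlgebroid

/-- The sign `(-1)^t` in the field `K`, for an integer exponent `t`. -/
def sgn (K : Type u) [Field K] (t : ℤ) : K := ((((-1 : Kˣ)) ^ t : Kˣ) : K)
/-! ### The graded space `⊕ₙ H^{⊗_R n}` -/

/-- Splicing a pure tensor: replace the slot `i` of `x₀ ⊗ ⋯ ⊗ x_n` by `u ⊗ v`. -/
def spliceAt {H : Type u} {n : ℕ} (x : Fin (n + 1) → H) (i : Fin (n + 1)) (u v : H) :
    Fin (n + 2) → H := fun j =>
  if _ : (j : ℕ) < (i : ℕ) then x ⟨(j : ℕ), by omega⟩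
  else if _ : (j : ℕ) = (i : ℕ) then u
  else if _ : (j : ℕ) = (i : ℕ) + 1 then v
  else x ⟨(j : ℕ) - 1, by have := j.isLt; omega⟩

section GradedSpace

variable (K : Type u) [Field K] [CharZero K]
variable (H : Type u) [Ring H] [Algebra K H]
variable {R : Type u} [Ring R] [Algebra K R]
variable (αf βf : R → H)

/-- The degree-`n` component `P_H(n)` of the graded space `⊕ₙ H^{⊗_R n}[-n]`:
`P_H(0) = R` and `P_H(n) = H^{⊗_R n}` for `n ≥ 1`. -/
@[reducible] def PH : ℕ → Type u
  | 0 => R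
  | (n + 1) => QT K H αf βf (n + 1)

instance PH.instAddCommGroup : ∀ n : ℕ, AddCommGroup (PH K H αf βf n)
  | 0 => inferInstanceAs (AddCommGroup R)
  | (n + 1) => inferInstanceAs (AddCommGroup (QT K H αf βf (n + 1)))

instance PH.instModule : ∀ n : ℕ, Module K (PH K H αf βf n)
  | 0 => inferInstanceAs (Module K R)
  | (n + 1) => inferInstanceAs (Module K (QT K H αf βf (n + 1)))

/-- Transport along an equality of degrees. -/
def phCast {a b : ℕ} (h : a = b) (x : PH K H αf βf a) : PH K H αf βf b := h ▸ x

end GradedSpace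
/-- Inserting a block `b` of length `m + 1` into slot `i` of the pure tensor
`x₀ ⊗ ⋯ ⊗ x_n` (the slot `i` is deleted; it is consumed by the block). -/
def insChain {H : Type u} {n m : ℕ} (i : Fin (n + 1)) (x : Fin (n + 1) → H)
    (b : Fin (m + 1) → H) : Fin (n + (m + 1)) → H := fun j =>
  if h1 : (j : ℕ) < (i : ℕ) then x ⟨(j : ℕ), by omega⟩
  else if h2 : (j : ℕ) < (i : ℕ) + (m + 1) then b ⟨(j : ℕ) - (i : ℕ), by omega⟩
  else x ⟨(j : ℕ) - m, by have := j.isLt; have := i.isLt; omega⟩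
section Shorthands

variable (K : Type u) [Field K] [CharZero K]
variable (H : Type u) [Ring H] [Algebra K H]
variable {R : Type u} [Ring R] [Algebra K R]

/-- Shorthand for the components of `⊕ₙ H^{⊗_R n}[-n]` attached to `(α, β)`. -/
@[reducible] def PHb (α : R →ₐ[K] H) (β : R →ₗ[K] H) : ℕ → Type u :=
  PH K H (fun a => α a) (fun a => β a)

/-- Shorthand for the quotient maps attached to `(α, β)`. -/
@[reducible] def qmk (α : R →ₐ[K] H) (β : R →ₗ[K] H) (n : ℕ) :
    TP K H n →ₗ[K] QT K H (fun a => α a) (fun a => β a) n :=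
  qtMk K H (fun a => α a) (fun a => β a) n

end Shorthands
/-! ### Twistor-type elements: common definitions -/

section TwistorBasics

variable {K : Type u} [Field K] [CharZero K]
variable {H : Type u} [Ring H] [Algebra K H]
variable {R : Type u} [Ring R] [Algebra K R]
variable {α : R →ₐ[K] H} {β : R →ₗ[K] H}

/-- Given a presentation `F = Σ_c (p c) ⊗_R (q c)` of an element of `H ⊗_R H`, the
induced product `a ⋆_F b := (F₁ ▷ a) · (F₂ ▷ b)` on `R`. -/
def starF (D : HopfAlgebroid K H R α β) {C : ℕ} (p q : Fin C → H) (a b : R) : R :=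
  ∑ c, D.hAct (p c) a * D.hAct (q c) b

/-- The twisted source map `α_F(a) := α(F₁ ▷ a) · F₂`. -/
def alphaF (D : HopfAlgebroid K H R α β) {C : ℕ} (p q : Fin C → H) (a : R) : H :=
  ∑ c, α (D.hAct (p c) a) * q c

/-- The twisted target map `β_F(a) := β(F₂ ▷ a) · F₁`. -/
def betaF (D : HopfAlgebroid K H R α β) {C : ℕ} (p q : Fin C → H) (a : R) : H :=
  ∑ c, β (D.hAct (q c) a) * p c

/-- The twistor equation (T1):
`(Δ ⊗_R id)(F) · (F ⊗_R 1) = (id ⊗_R Δ)(F) · (1 ⊗_R F)` in `H^{⊗_R 3}`, expressed via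
a presentation `F = Σ_c (p c) ⊗_R (q c)` and lifts `s c`, `t c` of `Δ(p c)`, `Δ(q c)`. -/
def TwistorEq1 (D : HopfAlgebroid K H R α β) {C : ℕ} (p q : Fin C → H)
    (s t : Fin C → TP K H 2) : Prop :=
  qtMk K H (fun a => α a) (fun a => β a) 3
      ((∑ c, (s c ⊗ₜ[K] q c : TP K H 3)) *
        (∑ c, ((p c ⊗ₜ[K] q c : TP K H 2) ⊗ₜ[K] (1 : H) : TP K H 3))) =
    qtMk K H (fun a => α a) (fun a => β a) 3
      ((∑ c, (TensorProduct.assoc K H H H).symm (p c ⊗ₜ[K] t c)) *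
        (∑ c, (TensorProduct.assoc K H H H).symm ((1 : H) ⊗ₜ[K] (p c ⊗ₜ[K] q c : TP K H 2))))

/-- The counit condition (T2): `(ε ⊗_R id)F = (id ⊗_R ε)F = 1`. -/
def TwistorEq2 (D : HopfAlgebroid K H R α β) {C : ℕ} (p q : Fin C → H) : Prop :=
  (∑ c, α (D.ε (p c)) * q c = 1) ∧ (∑ c, β (D.ε (q c)) * p c = 1)

end TwistorBasics
/-! ### Twistors of Hopf algebroids -/

section Twistors

variable {K : Type u} [Field K] [CharZero K]
variable {H : Type u} [Ring H] [Algebra K H]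
variable {R : Type u} [Ring R] [Algebra K R]

/-- The relations defining `M₁ ⊗_R M₂` for two left `H`-modules `M₁`, `M₂` (with actions
`ρ₁`, `ρ₂`), relative to source/target maps `αf, βf : R → H`. -/
def modRel (K : Type u) [Field K] {H : Type u} [Ring H] [Algebra K H]
    {R : Type u} (αf βf : R → H)
    {M₁ M₂ : Type u} [AddCommGroup M₁] [Module K M₁] [AddCommGroup M₂] [Module K M₂]
    (ρ₁ : H →ₐ[K] Module.End K M₁) (ρ₂ : H →ₐ[K] Module.End K M₂) :
    Submodule K (M₁ ⊗[K] M₂) :=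
  Submodule.span K
    {z | ∃ (r : R) (m : M₁) (m' : M₂),
      z = (ρ₁ (βf r) m) ⊗ₜ[K] m' - m ⊗ₜ[K] (ρ₂ (αf r) m')}

variable {α : R →ₐ[K] H} {β : R →ₗ[K] H}

/-- `F = Σ_c (p c) ⊗_R (q c)` is a **twistor** of the Hopf algebroid `H`: it satisfies
the twistor equation (T1) and the counit condition (T2), and for any two left
`H`-modules `M₁`, `M₂` the induced map `F♯ : M₁ ⊗_{R_F} M₂ → M₁ ⊗_R M₂` is invertible. -/
def IsTwistor (D : HopfAlgebroid K H R α β) {C : ℕ} (p q : Fin C → H) : Prop :=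
  (∃ s t : Fin C → TP K H 2,
    (∀ c, qmk K H α β 2 (s c) = D.Δ (p c)) ∧
    (∀ c, qmk K H α β 2 (t c) = D.Δ (q c)) ∧ TwistorEq1 D p q s t) ∧
  TwistorEq2 D p q ∧
  ∀ (M₁ : Type u) [AddCommGroup M₁] [Module K M₁]
    (M₂ : Type u) [AddCommGroup M₂] [Module K M₂]
    (ρ₁ : H →ₐ[K] Module.End K M₁) (ρ₂ : H →ₐ[K] Module.End K M₂),
    ∃ G : ((M₁ ⊗[K] M₂) ⧸ modRel K (alphaF D p q) (betaF D p q) ρ₁ ρ₂) →ₗ[K]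
        ((M₁ ⊗[K] M₂) ⧸ modRel K (fun a => α a) (fun a => β a) ρ₁ ρ₂),
      (∀ w : M₁ ⊗[K] M₂,
        G (Submodule.Quotient.mk w) =
          Submodule.Quotient.mk (∑ c, TensorProduct.map (ρ₁ (p c)) (ρ₂ (q c)) w)) ∧
      Function.Bijective G

variable (D : HopfAlgebroid K H R α β) {C : ℕ} (p q : Fin C → H)

/-- The family `e n` of lifts of the elements
`E_n = F_{1∧⋯∧n−1,n} ⋯ F_{1∧2,3} · F_{1,2} ∈ H^{⊗_R n}` (with `E₁ = 1`, `E₂ = F`,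
`E_{n+1} = (Δ^{n−1} ⊗_R id)(F) · (E_n ⊗_R 1)`). -/
def IsEChain (e : ∀ n : ℕ, TP K H n) : Prop :=
  (qmk K H α β 1 (e 1) = qmk K H α β 1 1) ∧
  (qmk K H α β 2 (e 2) = qmk K H α β 2 (∑ c, (p c ⊗ₜ[K] q c : TP K H 2))) ∧
  ∀ (n : ℕ) (CP : Fin C → ℕ) (ZP : (c : Fin C) → Fin (CP c) → Fin (n + 1) → H),
    (∀ c, qmk K H α β (n + 1) (∑ d, chainP K H (n + 1) (ZP c d)) = D.Δpow n (p c)) →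
    qmk K H α β (n + 2) (e (n + 2)) =
      qmk K H α β (n + 2)
        ((∑ c, ∑ d : Fin (CP c), chainP K H (n + 2) (Fin.snoc (ZP c d) (q c))) *
          (show TP K H (n + 2) from e (n + 1) ⊗ₜ[K] (1 : H)))

/-- The degreewise components `F♯ : H^{⊗_{R_F} n} → H^{⊗_R n}` of the map `F♯`:
`F♯(x₁ ⊗_{R_F} ⋯ ⊗_{R_F} x_n) = E_n · (x₁ ⊗_R ⋯ ⊗_R x_n)`, and `F♯ = id` in degree 0. -/
def IsFSharp (e : ∀ n : ℕ, TP K H n)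
    (Fs : ∀ n : ℕ, PH K H (alphaF D p q) (betaF D p q) n →ₗ[K]
        PH K H (fun a => α a) (fun a => β a) n) : Prop :=
  (∀ a : R, Fs 0 a = a) ∧
  ∀ (n : ℕ) (x : Fin (n + 1) → H),
    Fs (n + 1) (qtMk K H (alphaF D p q) (betaF D p q) (n + 1) (chainP K H (n + 1) x)) =
      qmk K H α β (n + 1) (e (n + 1) * chainP K H (n + 1) x)

/-- The binary brace operations `F{x, y}` with head the twistor `F`, on the graded space
`⊕ₙ H^{⊗_R n}`: on sums of pure tensors,
`F{x, y} = (−1)^{|x|(|y|−1)} (Δ^{|x|−1} ⊗ Δ^{|y|−1})(F) · (x ⊗_R y)`; insertions of the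
degree-`0` component `R` are absorbed through `α_F`, `β_F` and `⋆_F`. -/
def IsFBrace
    (Fbr : ∀ n m : ℕ, PH K H (fun a => α a) (fun a => β a) n →ₗ[K]
        PH K H (fun a => α a) (fun a => β a) m →ₗ[K]
        PH K H (fun a => α a) (fun a => β a) (n + m)) : Prop :=
  -- main clause: both arguments of degree `≥ 1`
  (∀ (n m : ℕ) (x : Fin (n + 1) → H) (y : Fin (m + 1) → H)
      (CP CQ : Fin C → ℕ)
      (ZP : (c : Fin C) → Fin (CP c) → Fin (n + 1) → H)
      (ZQ : (c : Fin C) → Fin (CQ c) → Fin (m + 1) → H),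
    (∀ c, qmk K H α β (n + 1) (∑ d, chainP K H (n + 1) (ZP c d)) = D.Δpow n (p c)) →
    (∀ c, qmk K H α β (m + 1) (∑ d, chainP K H (m + 1) (ZQ c d)) = D.Δpow m (q c)) →
    Fbr (n + 1) (m + 1)
        (qmk K H α β (n + 1) (chainP K H (n + 1) x))
        (qmk K H α β (m + 1) (chainP K H (m + 1) y)) =
      sgn K (((n : ℤ) + 1) * (m : ℤ)) •
        qmk K H α β ((n + 1) + (m + 1))
          (∑ c, ∑ d : Fin (CP c), ∑ d' : Fin (CQ c),
            chainP K H ((n + 1) + (m + 1))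
              (Fin.append (fun t => ZP c d t * x t) (fun t => ZQ c d' t * y t)))) ∧
  -- left argument of degree `0`: `F{a, y} = (Δ^{|y|−1} α_F(a)) · y`
  (∀ (m : ℕ) (a : R) (y : Fin (m + 1) → H) (CA : ℕ) (ZA : Fin CA → Fin (m + 1) → H),
    qmk K H α β (m + 1) (∑ d, chainP K H (m + 1) (ZA d)) = D.Δpow m (alphaF D p q a) →
    Fbr 0 (m + 1) a (qmk K H α β (m + 1) (chainP K H (m + 1) y)) =
      phCast K H (fun a => α a) (fun a => β a) (a := m + 1) (b := 0 + (m + 1)) (by omega)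
        (qmk K H α β (m + 1) (∑ d, chainP K H (m + 1) (fun t => ZA d t * y t)))) ∧
  -- right argument of degree `0`: `F{x, a} = (−1)^{|x|} (Δ^{|x|−1} β_F(a)) · x`
  (∀ (n : ℕ) (a : R) (x : Fin (n + 1) → H) (CB : ℕ) (ZB : Fin CB → Fin (n + 1) → H),
    qmk K H α β (n + 1) (∑ d, chainP K H (n + 1) (ZB d)) = D.Δpow n (betaF D p q a) →
    Fbr (n + 1) 0 (qmk K H α β (n + 1) (chainP K H (n + 1) x)) a =
      sgn K ((n : ℤ) + 1) •
        qmk K H α β (n + 1) (∑ d, chainP K H (n + 1) (fun t => ZB d t * x t))) ∧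
  -- both arguments of degree `0`: `F{a, b} = a ⋆_F b`
  (∀ a b : R, Fbr 0 0 a b = starF D p q a b)

end Twistors

/-! ### Generic concatenation products, iterated coproducts and compositions -/

section Generic

variable {K : Type u} [Field K] [CharZero K]
variable {H : Type u} [Ring H] [Algebra K H]
variable {R : Type u} [Ring R] [Algebra K R]

/-- The concatenation product on `⊕ₙ H^{⊗_R n}` relative to source/target maps
`αf, βf`, a product `mulR` on the degree-`0` part `R`, and a coefficient system `coef`
(`coef n m = (−1)^{nm}` for the cup product, `coef = 1` for the plain tensor
concatenation). -/
def IsConcatOn (αf βf : R → H) (mulR : R → R → R) (coef : ℕ → ℕ → K)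
    (cup : ∀ n m : ℕ, PH K H αf βf n →ₗ[K] PH K H αf βf m →ₗ[K] PH K H αf βf (n + m)) :
    Prop :=
  (∀ (n m : ℕ) (x : Fin (n + 1) → H) (y : Fin (m + 1) → H),
    cup (n + 1) (m + 1)
        (qtMk K H αf βf (n + 1) (chainP K H (n + 1) x))
        (qtMk K H αf βf (m + 1) (chainP K H (m + 1) y)) =
      coef (n + 1) (m + 1) •
        qtMk K H αf βf ((n + 1) + (m + 1))
          (chainP K H ((n + 1) + (m + 1)) (Fin.append x y))) ∧
  (∀ (m : ℕ) (a : R) (y : Fin (m + 1) → H),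
    cup 0 (m + 1) a (qtMk K H αf βf (m + 1) (chainP K H (m + 1) y)) =
      phCast K H αf βf (a := m + 1) (b := 0 + (m + 1)) (by omega)
        (qtMk K H αf βf (m + 1) (slotP K H (m + 1) 0 (αf a) * chainP K H (m + 1) y))) ∧
  (∀ (n : ℕ) (a : R) (x : Fin (n + 1) → H),
    cup (n + 1) 0 (qtMk K H αf βf (n + 1) (chainP K H (n + 1) x)) a =
      qtMk K H αf βf (n + 1) (slotP K H (n + 1) n (βf a) * chainP K H (n + 1) x)) ∧
  (∀ a b : R, cup 0 0 a b = mulR a b)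

/-- A family `Δp` is the family of iterated coproducts of a coproduct `Δ2`, relative to
source/target maps `αf, βf`. -/
def IsIteratedOn (αf βf : R → H) (Δ2 : H →ₗ[K] QT K H αf βf 2)
    (Δp : ∀ n : ℕ, H →ₗ[K] QT K H αf βf (n + 1)) : Prop :=
  (∀ x : H, Δp 0 x = qtMk K H αf βf 1 x) ∧
  (Δp 1 = Δ2) ∧
  ∀ (n : ℕ) (x : H) (C : ℕ) (uu vv : Fin C → H),
    qtMk K H αf βf 2 (∑ c, (uu c ⊗ₜ[K] vv c : TP K H 2)) = Δ2 x →
    ∀ s : Fin C → TP K H (n + 1),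
      (∀ c, qtMk K H αf βf (n + 1) (s c) = Δp n (uu c)) →
      Δp (n + 1) x = qtMk K H αf βf (n + 2) (∑ c, (s c ⊗ₜ[K] vv c : TP K H (n + 2)))

/-- The defining clauses of the operadic partial composition maps of the operad
`P_H` attached to the data `(αf, βf, act, Δp)`; cf. Statement 1. -/
def IsCompOn (αf βf : R → H) (act : H → R → R)
    (Δp : ∀ n : ℕ, H →ₗ[K] QT K H αf βf (n + 1))
    (comp : ∀ (n m : ℕ), Fin (n + 1) →
      (PH K H αf βf (n + 1) →ₗ[K] PH K H αf βf m →ₗ[K] PH K H αf βf (n + m))) : Prop :=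
  (∀ (n m : ℕ) (i : Fin (n + 1)) (x : Fin (n + 1) → H) (y : Fin (m + 1) → H)
      (C : ℕ) (z : Fin C → Fin (m + 1) → H),
    qtMk K H αf βf (m + 1) (∑ c, chainP K H (m + 1) (z c)) = Δp m (x i) →
    comp n (m + 1) i
        (qtMk K H αf βf (n + 1) (chainP K H (n + 1) x))
        (qtMk K H αf βf (m + 1) (chainP K H (m + 1) y)) =
      qtMk K H αf βf (n + (m + 1))
        (∑ c, chainP K H (n + (m + 1)) (insChain i x (fun t => z c t * y t)))) ∧
  (∀ (i : Fin 1) (h : H) (a : R),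
    comp 0 0 i (qtMk K H αf βf 1 h) a = act h a) ∧
  (∀ (n : ℕ) (i : Fin (n + 2)) (x : Fin (n + 2) → H) (a : R),
    comp (n + 1) 0 i (qtMk K H αf βf (n + 2) (chainP K H (n + 2) x)) a =
      qtMk K H αf βf (n + 1)
        (chainP K H (n + 1) (fun j : Fin (n + 1) =>
          if (i : ℕ) ≤ n then
            (if (j : ℕ) < (i : ℕ) then x ⟨(j : ℕ), by omega⟩
             else if (j : ℕ) = (i : ℕ) then αf (act (x i) a) * x ⟨(j : ℕ) + 1, by omega⟩
             else x ⟨(j : ℕ) + 1, by omega⟩)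
          else
            (if (j : ℕ) + 1 = n + 1 then βf (act (x i) a) * x ⟨(j : ℕ), by omega⟩
             else x ⟨(j : ℕ), by omega⟩))))

/-- Iterated binary operation `(⋯(y₁ ⊚ y₂) ⊚ ⋯ ) ⊚ y_k` on a graded family. -/
def foldOp {F : ℕ → Type u} (c : ∀ a b : ℕ, F a → F b → F (a + b)) :
    ∀ {k : ℕ} (deg : Fin (k + 1) → ℕ), ((i : Fin (k + 1)) → F (deg i)) → F (∑ i, deg i)
  | 0, deg, y => (show deg 0 = ∑ i, deg i by simp) ▸ y 0
  | (k + 1), deg, y =>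
      (show (∑ i : Fin (k + 1), deg i.castSucc) + deg (Fin.last (k + 1)) = ∑ i, deg i from
        (Fin.sum_univ_castSucc deg).symm) ▸
        c _ _ (foldOp c (fun i => deg i.castSucc) (fun i => y i.castSucc))
          (y (Fin.last (k + 1)))

end Generic
set_option linter.unusedSectionVars false
set_option linter.unusedVariables false
set_option linter.unusedSimpArgs false

theorem TwAux.zadd_eq (m : ℕ) : m = 0 + m := (Nat.zero_add m).symm
theorem TwAux.nadd_eq (n m l : ℕ) : n + (m + l) = n + m + l := (Nat.add_assoc n m l).symm
set_option linter.unusedSectionVars false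
set_option linter.unusedVariables false
set_option linter.unusedSimpArgs false
namespace TwAux

section Tens
variable {K : Type u} [Field K] [CharZero K] {H : Type u} [Ring H] [Algebra K H]
variable {M : Type*} [AddCommGroup M] [Module K M]

def tm (n : ℕ) : TP K H (n + 1) →ₗ[K] H →ₗ[K] TP K H (n + 2) :=
  TensorProduct.mk K (TP K H (n + 1)) H

def t1 : H →ₗ[K] TP K H 1 := LinearMap.id

def t2 : H →ₗ[K] H →ₗ[K] TP K H 2 := tm 0

theorem t1_mul (a b : H) : (t1 (a * b) : TP K H 1) = t1 a * t1 b := rfl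
theorem t1_one : (t1 1 : TP K H 1) = 1 := rfl

theorem t1_surj (t : TP K H 1) : ∃ h : H, t = t1 h := ⟨t, rfl⟩

theorem tm_mul (n : ℕ) (x y : TP K H (n + 1)) (h k : H) :
    tm n x h * tm n y k = tm n (x * y) (h * k) :=
  Algebra.TensorProduct.tmul_mul_tmul x y h k

theorem t2_mul (x y : H) (h k : H) :
    (t2 x h * t2 y k : TP K H 2) = t2 (x * y) (h * k) :=
  tm_mul 0 x y h k

theorem tm_one (n : ℕ) : tm n (1 : TP K H (n + 1)) (1 : H) = 1 := rfl

theorem tp_ind {n : ℕ} {P : TP K H (n + 2) → Prop} (h0 : P 0)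
    (ha : ∀ x y, P x → P y → P (x + y)) (ht : ∀ x h, P (tm n x h)) : ∀ t, P t := by
  intro t
  exact TensorProduct.induction_on (motive := P) t h0 ht ha

def tlift {n : ℕ} (f : TP K H (n + 1) →ₗ[K] H →ₗ[K] M) : TP K H (n + 2) →ₗ[K] M :=
  TensorProduct.lift f

theorem tlift_tm {n : ℕ} (f : TP K H (n + 1) →ₗ[K] H →ₗ[K] M) (x : TP K H (n + 1)) (h : H) :
    tlift f (tm n x h) = f x h := TensorProduct.lift.tmul x h

theorem tp_ext {n : ℕ} {f g : TP K H (n + 2) →ₗ[K] M}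
    (h : ∀ x k, f (tm n x k) = g (tm n x k)) : f = g := by
  ext t
  refine tp_ind (P := fun t => f t = g t) (by simp) ?_ h t
  intro x y hx hy
  simp [hx, hy]

theorem t2_ind {P : TP K H 2 → Prop} (h0 : P 0)
    (ha : ∀ x y, P x → P y → P (x + y)) (ht : ∀ x h, P (t2 x h)) : ∀ t, P t :=
  tp_ind h0 ha ht

theorem slot_one (i : ℕ) (h : H) : slotP K H 1 i h = t1 h := rfl

theorem slot_lt {n i : ℕ} (hi : i < n + 1) (h : H) :
    slotP K H (n + 2) i h = tm n (slotP K H (n + 1) i h) 1 := by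
  have : i ≠ n + 1 := by omega
  exact if_neg this

theorem slot_last (n : ℕ) (h : H) :
    slotP K H (n + 2) (n + 1) h = tm n 1 h := by
  exact if_pos rfl

theorem slot_mul_one (n i : ℕ) (hi : i < n + 1) : slotP K H (n + 1) i 1 = 1 := by
  induction n with
  | zero => rfl
  | succ n ih =>
    by_cases h : i = n + 1
    · subst h; rw [slot_last, tm_one]
    · rw [slot_lt (by omega), ih (by omega), tm_one]

theorem slot_add (n i : ℕ) (a b : H) :
    slotP K H (n + 1) i (a + b) = slotP K H (n + 1) i a + slotP K H (n + 1) i b := by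
  induction n with
  | zero => rfl
  | succ n ih =>
    by_cases h : i = n + 1
    · subst h; simp only [slot_last, map_add]
    · by_cases h' : i < n + 1
      · simp only [slot_lt h', ih, map_add, LinearMap.add_apply]
      · have e : ∀ h : H, slotP K H (n + 2) i h = tm n (slotP K H (n + 1) i h) 1 := by
          intro k; exact if_neg h
        simp only [e, ih, map_add, LinearMap.add_apply]

theorem slot_smul (n i : ℕ) (c : K) (a : H) :
    slotP K H (n + 1) i (c • a) = c • slotP K H (n + 1) i a := by
  induction n with
  | zero => rfl
  | succ n ih =>
    by_cases h : i = n + 1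
    · subst h; simp only [slot_last, map_smul]
    · have e : ∀ h : H, slotP K H (n + 2) i h = tm n (slotP K H (n + 1) i h) 1 := by
        intro k; exact if_neg h
      simp only [e, ih, map_smul, LinearMap.smul_apply]

theorem slot_comm (n i j : ℕ) (hij : i ≠ j) (hi : i < n + 1) (hj : j < n + 1) (a b : H) :
    slotP K H (n + 1) i a * slotP K H (n + 1) j b =
      slotP K H (n + 1) j b * slotP K H (n + 1) i a := by
  induction n with
  | zero => omega
  | succ n ih =>
    rcases Nat.lt_or_ge i (n+1) with h | h
    · rcases Nat.lt_or_ge j (n+1) with h' | h'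
      · simp only [slot_lt h, slot_lt h', tm_mul, ih h h']
      · obtain rfl : j = n + 1 := by omega
        simp only [slot_lt h, slot_last, tm_mul, mul_one, one_mul]
    · obtain rfl : i = n + 1 := by omega
      have h' : j < n + 1 := by omega
      simp only [slot_lt h', slot_last, tm_mul, mul_one, one_mul]

theorem slot_mul (n i : ℕ) (hi : i < n + 1) (a b : H) :
    slotP K H (n + 1) i (a * b) = slotP K H (n + 1) i a * slotP K H (n + 1) i b := by
  induction n with
  | zero => rfl
  | succ n ih =>
    rcases Nat.lt_or_ge i (n+1) with h | h
    · simp only [slot_lt h, tm_mul, ih h, mul_one]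
    · obtain rfl : i = n + 1 := by omega
      simp only [slot_last, tm_mul, mul_one]

/-- concatenation -/
def catT (n : ℕ) : (m : ℕ) → TP K H (n + 1) →ₗ[K] TP K H (m + 1) →ₗ[K] TP K H (n + 1 + (m + 1))
  | 0 => tm n
  | (m + 1) =>
    { toFun := fun x => tlift ((tm (n + 1 + m)) ∘ₗ (catT n m x))
      map_add' := by
        intro x y; apply tp_ext; intro t k
        simp [tlift_tm]
      map_smul' := by
        intro c x; apply tp_ext; intro t k
        simp [tlift_tm] }

theorem catT_one (n : ℕ) (x : TP K H (n + 1)) (h : H) : catT n 0 x (t1 h) = tm n x h := rfl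

theorem catT_tm (n m : ℕ) (x : TP K H (n + 1)) (y : TP K H (m + 1)) (h : H) :
    catT n (m + 1) x (tm m y h) = tm (n + 1 + m) (catT n m x y) h := by
  show tlift _ _ = _
  rw [tlift_tm]; rfl

theorem catT_mul (n m : ℕ) (x x' : TP K H (n + 1)) (y y' : TP K H (m + 1)) :
    catT n m x y * catT n m x' y' = catT n m (x * x') (y * y') := by
  induction m with
  | zero => exact tm_mul n x x' y y'
  | succ m ih =>
    refine tp_ind (P := fun y => catT n (m+1) x y * catT n (m+1) x' y' = catT n (m+1) (x * x') (y * y')) (by simp) ?_ ?_ y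
    · intro a b ha hb; simp only [map_add, add_mul, ha, hb]
    · intro y h
      refine tp_ind (P := fun y' => catT n (m+1) x (tm m y h) * catT n (m+1) x' y' = catT n (m+1) (x * x') ((tm m y h) * y')) (by simp) ?_ ?_ y'
      · intro a b ha hb; simp only [map_add, mul_add, ha, hb]
      · intro y' h'
        simp only [catT_tm, tm_mul, ih]

theorem catT_one_one (n m : ℕ) : catT n m (1 : TP K H (n+1)) (1 : TP K H (m + 1)) = 1 := by
  induction m with
  | zero => rfl
  | succ m ih => rw [← tm_one, catT_tm, ih]; rfl

theorem catT_slot_left (n m i : ℕ) (hi : i < n + 1) (a : H) :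
    catT n m (slotP K H (n + 1) i a) 1 = slotP K H (n + 1 + (m + 1)) i a := by
  induction m with
  | zero => exact (slot_lt hi a).symm
  | succ m ih =>
    rw [← tm_one, catT_tm, ih]
    exact (slot_lt (n := n + 1 + m) (by omega) a).symm

theorem catT_slot_right (n m i : ℕ) (hi : i < m + 1) (a : H) :
    catT n m 1 (slotP K H (m + 1) i a) = slotP K H (n + 1 + (m + 1)) (n + 1 + i) a := by
  induction m with
  | zero =>
    obtain rfl : i = 0 := by omega
    exact (slot_last n a).symm
  | succ m ih =>
    rcases Nat.lt_or_ge i (m+1) with h | h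
    · rw [slot_lt h, catT_tm, ih h]
      exact (slot_lt (n := n + 1 + m) (by omega) a).symm
    · obtain rfl : i = m + 1 := by omega
      rw [slot_last, catT_tm, catT_one_one]
      exact (slot_last (n + 1 + m) a).symm

theorem chain_one (x : Fin (0 + 1) → H) : chainP K H (0 + 1) x = t1 (x 0) := by
  simp [chainP]; rfl

theorem chain_succ (n : ℕ) (x : Fin (n + 2) → H) :
    chainP K H (n + 2) x = tm n (chainP K H (n + 1) (fun i => x i.castSucc)) (x (Fin.last _)) := by
  have key : ∀ l : List (TP K H (n + 1)), (l.map (fun t => tm n t (1 : H))).prod = tm n l.prod 1 := by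
    intro l
    induction l with
    | nil => exact (tm_one n).symm
    | cons a l ih => rw [List.map_cons, List.prod_cons, ih, tm_mul, List.prod_cons, mul_one]
  have h2 : (fun i : Fin (n + 1) => slotP K H (n + 2) (i : ℕ) (x i.castSucc)) =
      (fun t => tm n t (1 : H)) ∘ (fun i : Fin (n + 1) => slotP K H (n + 1) (i : ℕ) (x i.castSucc)) := by
    funext i
    exact slot_lt i.isLt _
  unfold chainP
  rw [List.ofFn_succ', List.prod_concat]
  simp only [Fin.val_castSucc, Fin.val_last, slot_last]
  rw [h2, ← List.map_ofFn, key, tm_mul, mul_one, one_mul]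

theorem chain_mul (n : ℕ) (x y : Fin (n + 1) → H) :
    chainP K H (n + 1) x * chainP K H (n + 1) y = chainP K H (n + 1) (fun t => x t * y t) := by
  induction n with
  | zero => rw [chain_one, chain_one, chain_one]; rfl
  | succ n ih => simp only [chain_succ, tm_mul, ih]

theorem chain_append (n m : ℕ) (x : Fin (n + 1) → H) (y : Fin (m + 1) → H) :
    catT n m (chainP K H (n + 1) x) (chainP K H (m + 1) y) =
      chainP K H (n + 1 + (m + 1)) (Fin.append x y) := by
  induction m with
  | zero =>
    rw [chain_one, catT_one]
    refine Eq.trans ?_ (chain_succ n _).symm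
    congr 2
    · congr 1; funext i; exact (Fin.append_left x y i).symm
    · exact (Fin.append_right x y 0).symm
  | succ m ih =>
    rw [chain_succ, catT_tm, ih]
    refine Eq.trans ?_ (chain_succ (n + 1 + m) _).symm
    congr 2
    · congr 1; funext i
      refine Fin.addCases (m := n + 1) (n := m + 1) (fun j => ?_) (fun j => ?_) i
      · rw [Fin.append_left]; exact (Fin.append_left x y j).symm
      · rw [Fin.append_right]; exact (Fin.append_right x y j.castSucc).symm
    · exact (Fin.append_right x y (Fin.last _)).symm

/-- chains span -/
theorem chain_ind {n : ℕ} {P : TP K H (n + 1) → Prop} (h0 : P 0)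
    (ha : ∀ x y, P x → P y → P (x + y)) (ht : ∀ x, P (chainP K H (n + 1) x)) : ∀ t, P t := by
  induction n with
  | zero =>
    intro t
    have := ht (fun _ => t)
    have e := chain_one (K := K) (H := H) (fun _ => t)
    rw [e] at this; exact this
  | succ n ih =>
    refine tp_ind h0 ha ?_
    intro x h
    refine ih (P := fun x => P (tm n x h)) ?_ ?_ ?_ x
    · simpa using h0
    · intro a b h1 h2
      rw [map_add, LinearMap.add_apply]; exact ha _ _ h1 h2
    · intro z
      have := ht (Fin.snoc (α := fun _ => H) z h)
      rw [chain_succ] at this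
      simpa using this

end Tens
end TwAux

namespace TwAux
section Quot
variable {K : Type u} [Field K] [CharZero K] {H : Type u} [Ring H] [Algebra K H]
variable {R : Type u} [Ring R] [Algebra K R]
variable {M : Type*} [AddCommGroup M] [Module K M]
variable {αf βf : R → H}

theorem mk_eq {n : ℕ} {x y : TP K H n} :
    qtMk K H αf βf n x = qtMk K H αf βf n y ↔ x - y ∈ Idl K H αf βf n :=
  Submodule.Quotient.eq _

theorem mk_zero {n : ℕ} {x : TP K H n} :
    qtMk K H αf βf n x = 0 ↔ x ∈ Idl K H αf βf n :=
  Submodule.Quotient.mk_eq_zero _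

theorem mk_surj {n : ℕ} (x : QT K H αf βf n) : ∃ t, x = qtMk K H αf βf n t := by
  obtain ⟨t, rfl⟩ := Submodule.mkQ_surjective _ x
  exact ⟨t, rfl⟩

theorem idl_mul {n : ℕ} {z : TP K H n} (hz : z ∈ Idl K H αf βf n) (x : TP K H n) :
    z * x ∈ Idl K H αf βf n := by
  unfold Idl at hz
  induction hz using Submodule.span_induction with
  | mem z h =>
    obtain ⟨r, i, y, hi, rfl⟩ := h
    exact Submodule.subset_span ⟨r, i, y * x, hi, by rw [mul_assoc]⟩
  | zero => rw [zero_mul]; exact Submodule.zero_mem _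
  | add a b _ _ ha hb => rw [add_mul]; exact Submodule.add_mem _ ha hb
  | smul c a _ ha => rw [Algebra.smul_mul_assoc]; exact Submodule.smul_mem _ _ ha

theorem mk_mul_congr {n : ℕ} {x y : TP K H n} (h : qtMk K H αf βf n x = qtMk K H αf βf n y)
    (t : TP K H n) : qtMk K H αf βf n (x * t) = qtMk K H αf βf n (y * t) := by
  rw [mk_eq] at h ⊢
  rw [← sub_mul]; exact idl_mul h t

theorem idl_kill {n : ℕ} (f : TP K H n →ₗ[K] M)
    (h : ∀ (r : R) (i : ℕ) (x : TP K H n), i + 2 ≤ n → f (relator K H αf βf n r i * x) = 0) :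
    ∀ z ∈ Idl K H αf βf n, f z = 0 := by
  intro z hz
  have : Idl K H αf βf n ≤ LinearMap.ker f := by
    refine Submodule.span_le.2 ?_
    rintro z ⟨r, i, x, hi, rfl⟩
    exact h r i x hi
  exact this hz

theorem idl_one {z : TP K H (0 + 1)} (hz : z ∈ Idl K H αf βf (0 + 1)) : z = 0 :=
  idl_kill (αf := αf) (βf := βf) LinearMap.id (fun _ _ _ h => by omega) z hz

theorem rel_lt {n i : ℕ} (hi : i < n) (r : R) :
    relator K H αf βf (n + 2) r i = tm n (relator K H αf βf (n + 1) r i) 1 := by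
  unfold relator
  rw [slot_lt (by omega), slot_lt (by omega), map_sub, LinearMap.sub_apply]

theorem rel_last (n : ℕ) (r : R) :
    relator K H αf βf (n + 2) r n = tm n (slotP K H (n + 1) n (βf r)) 1 - tm n 1 (αf r) := by
  unfold relator
  rw [slot_lt (by omega), slot_last]

theorem tm_idl {n : ℕ} {z : TP K H (n + 1)} (hz : z ∈ Idl K H αf βf (n + 1)) (h : H) :
    tm n z h ∈ Idl K H αf βf (n + 2) := by
  have := idl_kill (αf := αf) (βf := βf) ((qtMk K H αf βf (n + 2)) ∘ₗ (tm n).flip h) (by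
    intro r i x hi
    rw [LinearMap.comp_apply, mk_zero, LinearMap.flip_apply]
    have e : tm n (relator K H αf βf (n + 1) r i * x) h =
        relator K H αf βf (n + 2) r i * tm n x h := by
      rw [rel_lt (by omega), tm_mul, one_mul]
    rw [e]
    exact Submodule.subset_span ⟨r, i, _, by omega, rfl⟩) z hz
  exact mk_zero.1 this

theorem mk_tm_congr {n : ℕ} {x y : TP K H (n + 1)}
    (h : qtMk K H αf βf (n + 1) x = qtMk K H αf βf (n + 1) y) (k : H) :
    qtMk K H αf βf (n + 2) (tm n x k) = qtMk K H αf βf (n + 2) (tm n y k) := by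
  rw [mk_eq] at h ⊢
  rw [← LinearMap.sub_apply, ← map_sub]; exact tm_idl h k

theorem tm_cross (n : ℕ) (r : R) (t : TP K H (n + 1)) (h : H) :
    qtMk K H αf βf (n + 2) (tm n (slotP K H (n + 1) n (βf r) * t) h) =
      qtMk K H αf βf (n + 2) (tm n t (αf r * h)) := by
  rw [mk_eq]
  refine Submodule.subset_span ⟨r, n, tm n t h, by omega, ?_⟩
  rw [rel_last, sub_mul, tm_mul, tm_mul, one_mul, one_mul]

theorem tm_kill {n : ℕ} (f : TP K H (n + 2) →ₗ[K] M)
    (h1 : ∀ z ∈ Idl K H αf βf (n + 1), ∀ h, f (tm n z h) = 0)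
    (h2 : ∀ (r : R) t h, f (tm n (slotP K H (n + 1) n (βf r) * t) h) = f (tm n t (αf r * h))) :
    ∀ z ∈ Idl K H αf βf (n + 2), f z = 0 := by
  refine idl_kill f ?_
  intro r i x hi
  refine tp_ind (P := fun x => f (relator K H αf βf (n + 2) r i * x) = 0) (by simp) ?_ ?_ x
  · intro a b ha hb; rw [mul_add, map_add, ha, hb, add_zero]
  · intro t h
    rcases Nat.lt_or_ge i n with hlt | hge
    · rw [rel_lt hlt, tm_mul]
      exact h1 _ (Submodule.subset_span ⟨r, i, t, by omega, rfl⟩) _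
    · obtain rfl : i = n := by omega
      rw [rel_last, sub_mul, tm_mul, tm_mul, one_mul, one_mul, map_sub, h2, sub_self]

theorem t2_kill (f : TP K H 2 →ₗ[K] M)
    (h2 : ∀ (r : R) (t h : H), f (t2 (βf r * t) h) = f (t2 t (αf r * h))) :
    ∀ z ∈ Idl K H αf βf 2, f z = 0 := by
  refine tm_kill (n := 0) f ?_ ?_
  · intro z hz h
    rw [idl_one hz]; simp
  · intro r t h
    exact h2 r t h

theorem catT_idl_left {n : ℕ} (m : ℕ) {z : TP K H (n + 1)} (hz : z ∈ Idl K H αf βf (n + 1))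
    (y : TP K H (m + 1)) : catT n m z y ∈ Idl K H αf βf (n + 1 + (m + 1)) := by
  induction m with
  | zero => exact tm_idl hz y
  | succ m ih =>
    refine tp_ind (P := fun y => catT n (m+1) z y ∈ Idl K H αf βf (n + 1 + (m + 1 + 1))) ?_ ?_ ?_ y
    · rw [map_zero]; exact Submodule.zero_mem _
    · intro a b ha hb; rw [map_add]; exact Submodule.add_mem _ ha hb
    · intro y h; rw [catT_tm]; exact tm_idl (ih y) h

theorem slot_catT_left (n m i : ℕ) (hi : i < n + 1) (a : H) (x : TP K H (n + 1))
    (y : TP K H (m + 1)) :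
    catT n m (slotP K H (n + 1) i a * x) y = slotP K H (n + 1 + (m + 1)) i a * catT n m x y := by
  rw [← catT_slot_left n m i hi, catT_mul, one_mul]

theorem slot_catT_right (n m i : ℕ) (hi : i < m + 1) (a : H) (x : TP K H (n + 1))
    (y : TP K H (m + 1)) :
    catT n m x (slotP K H (m + 1) i a * y) =
      slotP K H (n + 1 + (m + 1)) (n + 1 + i) a * catT n m x y := by
  rw [← catT_slot_right n m i hi, catT_mul, one_mul]

theorem catT_cross (n m : ℕ) (r : R) (x : TP K H (n + 1)) (y : TP K H (m + 1)) :
    qtMk K H αf βf (n + 1 + (m + 1)) (catT n m (slotP K H (n + 1) n (βf r) * x) y) =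
      qtMk K H αf βf (n + 1 + (m + 1)) (catT n m x (slotP K H (m + 1) 0 (αf r) * y)) := by
  induction m with
  | zero => exact tm_cross n r x y
  | succ m ih =>
    refine tp_ind (P := fun y => qtMk K H αf βf (n + 1 + (m + 1 + 1)) (catT n (m + 1) (slotP K H (n + 1) n (βf r) * x) y) =
      qtMk K H αf βf (n + 1 + (m + 1 + 1)) (catT n (m + 1) x (slotP K H (m + 1 + 1) 0 (αf r) * y))) ?_ ?_ ?_ y
    · simp
    · intro a b ha hb; simp only [mul_add, map_add, ha, hb]
    · intro y h
      rw [catT_tm, slot_lt (by omega), tm_mul, one_mul, catT_tm]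
      exact mk_tm_congr (ih y) h

theorem catT_idl_right (n : ℕ) {m : ℕ} (x : TP K H (n + 1)) {z : TP K H (m + 1)}
    (hz : z ∈ Idl K H αf βf (m + 1)) : catT n m x z ∈ Idl K H αf βf (n + 1 + (m + 1)) := by
  induction m with
  | zero => rw [idl_one hz, map_zero]; exact Submodule.zero_mem _
  | succ m ih =>
    refine mk_zero.1 (tm_kill (αf := αf) (βf := βf)
      (qtMk K H αf βf (n + 1 + (m + 1 + 1)) ∘ₗ catT n (m + 1) x) ?_ ?_ z hz)
    · intro z hz h
      rw [LinearMap.comp_apply, catT_tm, mk_zero]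
      exact tm_idl (ih hz) h
    · intro r t h
      rw [LinearMap.comp_apply, LinearMap.comp_apply, catT_tm, catT_tm,
        slot_catT_right _ _ _ (by omega)]
      exact tm_cross (n + 1 + m) r _ h

/-- lifting bilinear maps to the quotients -/
def lift2 {a b : ℕ} (f : TP K H a →ₗ[K] TP K H b →ₗ[K] M)
    (h1 : ∀ z ∈ Idl K H αf βf a, ∀ y, f z y = 0)
    (h2 : ∀ x, ∀ z ∈ Idl K H αf βf b, f x z = 0) :
    QT K H αf βf a →ₗ[K] QT K H αf βf b →ₗ[K] M :=
  (Idl K H αf βf a).liftQ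
    (LinearMap.flip ((Idl K H αf βf b).liftQ f.flip (by
      intro z hz; rw [LinearMap.mem_ker]; ext x; exact h2 x z hz)))
    (by
      intro z hz
      rw [LinearMap.mem_ker]
      ext y
      exact h1 z hz y)

theorem lift2_mk {a b : ℕ} (f : TP K H a →ₗ[K] TP K H b →ₗ[K] M)
    (h1 : ∀ z ∈ Idl K H αf βf a, ∀ y, f z y = 0)
    (h2 : ∀ x, ∀ z ∈ Idl K H αf βf b, f x z = 0) (x : TP K H a) (y : TP K H b) :
    lift2 f h1 h2 (qtMk K H αf βf a x) (qtMk K H αf βf b y) = f x y := rfl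

variable (αf βf) in
def catQ (n m : ℕ) : QT K H αf βf (n + 1) →ₗ[K] QT K H αf βf (m + 1) →ₗ[K]
    QT K H αf βf (n + 1 + (m + 1)) :=
  lift2 ((catT n m).compr₂ (qtMk K H αf βf (n + 1 + (m + 1))))
    (fun z hz y => mk_zero.2 (catT_idl_left m hz y))
    (fun x z hz => mk_zero.2 (catT_idl_right n x hz))

theorem catQ_mk (n m : ℕ) (x : TP K H (n + 1)) (y : TP K H (m + 1)) :
    catQ αf βf n m (qtMk K H αf βf (n + 1) x) (qtMk K H αf βf (m + 1) y) =
      qtMk K H αf βf (n + 1 + (m + 1)) (catT n m x y) := rfl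

theorem comm_idl {n : ℕ} (g : TP K H n)
    (h : ∀ (r : R) i, i + 2 ≤ n → g * relator K H αf βf n r i = relator K H αf βf n r i * g) :
    ∀ z ∈ Idl K H αf βf n, g * z ∈ Idl K H αf βf n := by
  intro z hz
  refine mk_zero.1 (idl_kill (αf := αf) (βf := βf) (qtMk K H αf βf n ∘ₗ LinearMap.mulLeft K g) ?_ z hz)
  intro r i x hi
  rw [LinearMap.comp_apply, LinearMap.mulLeft_apply, mk_zero, ← mul_assoc, h r i hi, mul_assoc]
  exact Submodule.subset_span ⟨r, i, _, hi, rfl⟩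

theorem slot_zero_idl (hc : ∀ a b, αf a * βf b = βf b * αf a) (n : ℕ) (a : R) :
    ∀ z ∈ Idl K H αf βf (n + 1), slotP K H (n + 1) 0 (αf a) * z ∈ Idl K H αf βf (n + 1) := by
  refine comm_idl _ ?_
  intro r i hi
  unfold relator
  rw [mul_sub, sub_mul, slot_comm n 0 (i + 1) (by omega) (by omega) (by omega)]
  congr 1
  rcases Nat.eq_zero_or_pos i with rfl | h
  · rw [← slot_mul _ _ (by omega), ← slot_mul _ _ (by omega), hc]
  · rw [slot_comm n 0 i (by omega) (by omega) (by omega)]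

theorem slot_top_idl (hc : ∀ a b, αf a * βf b = βf b * αf a) (n : ℕ) (a : R) :
    ∀ z ∈ Idl K H αf βf (n + 1), slotP K H (n + 1) n (βf a) * z ∈ Idl K H αf βf (n + 1) := by
  refine comm_idl _ ?_
  intro r i hi
  unfold relator
  rw [mul_sub, sub_mul, slot_comm n n i (by omega) (by omega) (by omega)]
  congr 1
  by_cases h : i + 1 = n
  · subst h
    rw [← slot_mul _ _ (by omega), ← slot_mul _ _ (by omega), hc]
  · rw [slot_comm n n (i + 1) (by omega) (by omega) (by omega)]

def lact (g : R → H) (hg : IsLinearMap K g) (n i : ℕ)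
    (h : ∀ a, ∀ z ∈ Idl K H αf βf (n + 1), slotP K H (n + 1) i (g a) * z ∈ Idl K H αf βf (n + 1)) :
    R →ₗ[K] QT K H αf βf (n + 1) →ₗ[K] QT K H αf βf (n + 1) where
  toFun a := (Idl K H αf βf (n + 1)).mapQ (Idl K H αf βf (n + 1))
    (LinearMap.mulLeft K (slotP K H (n + 1) i (g a))) (fun z hz => h a z hz)
  map_add' a b := by
    ext t
    show qtMk K H αf βf (n + 1) (slotP K H (n + 1) i (g (a + b)) * t) =
      qtMk K H αf βf (n + 1) (slotP K H (n + 1) i (g a) * t) +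
      qtMk K H αf βf (n + 1) (slotP K H (n + 1) i (g b) * t)
    rw [hg.map_add, slot_add, add_mul, map_add]
  map_smul' c a := by
    ext t
    show qtMk K H αf βf (n + 1) (slotP K H (n + 1) i (g (c • a)) * t) =
      c • qtMk K H αf βf (n + 1) (slotP K H (n + 1) i (g a) * t)
    rw [hg.map_smul, slot_smul, Algebra.smul_mul_assoc, map_smul]

theorem lact_mk (g : R → H) (hg : IsLinearMap K g) (n i : ℕ)
    (h : ∀ a, ∀ z ∈ Idl K H αf βf (n + 1), slotP K H (n + 1) i (g a) * z ∈ Idl K H αf βf (n + 1))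
    (a : R) (t : TP K H (n + 1)) :
    lact g hg n i h a (qtMk K H αf βf (n + 1) t) =
      qtMk K H αf βf (n + 1) (slotP K H (n + 1) i (g a) * t) := rfl

variable (K αf βf) in
/-- `phCast` as a linear map -/
def phc {a b : ℕ} (h : a = b) : PH K H αf βf a →ₗ[K] PH K H αf βf b where
  toFun := phCast K H αf βf h
  map_add' x y := by subst h; rfl
  map_smul' c x := by subst h; rfl

theorem phc_rfl {a : ℕ} (h : a = a) (x : PH K H αf βf a) : phc K αf βf h x = x := rfl

theorem phc_phc {a b c : ℕ} (h : a = b) (h' : b = c) (x : PH K H αf βf a) :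
    phc K αf βf h' (phc K αf βf h x) = phc K αf βf (h.trans h') x := by
  subst h; subst h'; rfl

def conc (hα : IsLinearMap K αf) (hβ : IsLinearMap K βf)
    (hc : ∀ a b, αf a * βf b = βf b * αf a) (mulR : R →ₗ[K] R →ₗ[K] R) :
    ∀ n m : ℕ, PH K H αf βf n →ₗ[K] PH K H αf βf m →ₗ[K] PH K H αf βf (n + m)
  | 0, 0 => mulR
  | 0, (m + 1) => (lact αf hα m 0 (slot_zero_idl hc m)).compr₂
      (phc K αf βf (show m + 1 = 0 + (m + 1) by omega))
  | (n + 1), 0 => (lact βf hβ n n (slot_top_idl hc n)).flip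
  | (n + 1), (m + 1) => catQ αf βf n m

variable (hα : IsLinearMap K αf) (hβ : IsLinearMap K βf)
    (hc : ∀ a b, αf a * βf b = βf b * αf a) (mulR : R →ₗ[K] R →ₗ[K] R)

theorem conc_00 (a b : R) : conc hα hβ hc mulR 0 0 a b = mulR a b := rfl
theorem conc_0s (m : ℕ) (a : R) (t : TP K H (m + 1)) :
    conc hα hβ hc mulR 0 (m + 1) a (qtMk K H αf βf (m + 1) t) =
      phc K αf βf (show m + 1 = 0 + (m + 1) by omega)
        (qtMk K H αf βf (m + 1) (slotP K H (m + 1) 0 (αf a) * t)) := rfl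
theorem conc_s0 (n : ℕ) (a : R) (t : TP K H (n + 1)) :
    conc hα hβ hc mulR (n + 1) 0 (qtMk K H αf βf (n + 1) t) a =
        (qtMk K H αf βf (n + 1) (slotP K H (n + 1) n (βf a) * t)) := rfl
theorem conc_ss (n m : ℕ) (x : TP K H (n + 1)) (y : TP K H (m + 1)) :
    conc hα hβ hc mulR (n + 1) (m + 1) (qtMk K H αf βf (n + 1) x) (qtMk K H αf βf (m + 1) y) =
      qtMk K H αf βf (n + 1 + (m + 1)) (catT n m x y) := rfl

/-- casts of tensor powers -/
def tpc {a b : ℕ} (h : a = b) : TP K H a →ₗ[K] TP K H b where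
  toFun := fun t => cast (by rw [h]) t
  map_add' x y := by subst h; rfl
  map_smul' c x := by subst h; rfl

theorem phc_mk {a b : ℕ} (h : a + 1 = b + 1) (t : TP K H (a + 1)) :
    phc K αf βf h (qtMk K H αf βf (a + 1) t) = qtMk K H αf βf (b + 1) (tpc h t) := by
  obtain rfl : a = b := by omega
  rfl

theorem tm_tpc {a b : ℕ} (h : a + 1 = b + 1) (h' : a + 2 = b + 2) (t : TP K H (a + 1)) (k : H) :
    tpc h' (tm a t k) = tm b (tpc h t) k := by
  obtain rfl : a = b := by omega
  rfl

theorem catT_assoc (n m l : ℕ) (x : TP K H (n + 1)) (y : TP K H (m + 1)) (z : TP K H (l + 1)) :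
    tpc (by omega : (n + 1 + (m + 1)) + (l + 1) = (n + 1) + ((m + 1) + (l + 1)))
      (catT (n + 1 + m) l (catT n m x y) z) = catT n (m + 1 + l) x (catT m l y z) := by
  induction l with
  | zero =>
    exact (catT_tm n m x y z).symm
  | succ l ih =>
    refine tp_ind (P := fun z =>
      tpc (by omega : (n + 1 + (m + 1)) + (l + 1 + 1) = (n + 1) + ((m + 1) + (l + 1 + 1)))
      (catT (n + 1 + m) (l + 1) (catT n m x y) z) =
        catT n (m + 1 + (l + 1)) x (catT m (l + 1) y z)) ?_ ?_ ?_ z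
    · simp only [map_zero]
    · intro a b ha hb; simp only [map_add, ha, hb]
    · intro z h
      rw [catT_tm, catT_tm]
      refine Eq.trans ?_ (catT_tm n (m + 1 + l) x _ h).symm
      rw [← ih]
      exact tm_tpc _ _ _ _

end Quot
end TwAux

namespace TwAux
section Hopf
variable {K : Type u} [Field K] [CharZero K] {H : Type u} [Ring H] [Algebra K H]
variable {R : Type u} [Ring R] [Algebra K R]
variable {M : Type*} [AddCommGroup M] [Module K M]

def t2lift (f : H →ₗ[K] H →ₗ[K] M) : TP K H 2 →ₗ[K] M := TensorProduct.lift f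
theorem t2lift_t2 (f : H →ₗ[K] H →ₗ[K] M) (u v : H) : t2lift f (t2 u v) = f u v :=
  TensorProduct.lift.tmul u v

theorem t2_sum (s : TP K H 2) : ∃ (C : ℕ) (uu vv : Fin C → H), s = ∑ c, t2 (uu c) (vv c) := by
  refine t2_ind (P := fun s => ∃ (C : ℕ) (uu vv : Fin C → H), s = ∑ c, t2 (uu c) (vv c))
    ⟨0, Fin.elim0, Fin.elim0, by simp⟩ ?_ ?_ s
  · rintro _ _ ⟨C, u, v, rfl⟩ ⟨C', u', v', rfl⟩
    refine ⟨C + C', Fin.append u u', Fin.append v v', ?_⟩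
    rw [Fin.sum_univ_add]; simp
  · intro x h
    exact ⟨1, fun _ => x, fun _ => h, by simp⟩

theorem chain_sum (n : ℕ) (s : TP K H (n + 1)) :
    ∃ (C : ℕ) (Z : Fin C → Fin (n + 1) → H), s = ∑ c, chainP K H (n + 1) (Z c) := by
  refine chain_ind (P := fun s => ∃ (C : ℕ) (Z : Fin C → Fin (n + 1) → H),
    s = ∑ c, chainP K H (n + 1) (Z c)) ⟨0, Fin.elim0, by simp⟩ ?_ ?_ s
  · rintro _ _ ⟨C, u, rfl⟩ ⟨C', u', rfl⟩
    refine ⟨C + C', Fin.append u u', ?_⟩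
    rw [Fin.sum_univ_add]; simp
  · intro x
    exact ⟨1, fun _ => x, by simp⟩

def a3 : H →ₗ[K] TP K H 2 →ₗ[K] TP K H 3 :=
  (TensorProduct.mk K H (H ⊗[K] H)).compr₂ (TensorProduct.assoc K H H H).symm.toLinearMap

theorem a3_t2 (u v w : H) : (a3 u (t2 v w) : TP K H 3) = tm 1 (t2 u v) w := rfl

variable {α : R →ₐ[K] H} {β : R →ₗ[K] H} (D : HopfAlgebroid K H R α β)

local notation "MK" => qtMk K H (fun a => α a) (fun a => β a)
local notation "ID" => Idl K H (fun a => α a) (fun a => β a)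

def dd : H →ₗ[K] TP K H 2 :=
  (Classical.choose (LinearMap.exists_rightInverse_of_surjective (MK 2)
    (LinearMap.range_eq_top.2 (Submodule.mkQ_surjective _)))) ∘ₗ D.Δ

theorem mk_dd (h : H) : MK 2 (dd D h) = D.Δ h :=
  LinearMap.congr_fun (Classical.choose_spec (LinearMap.exists_rightInverse_of_surjective (MK 2)
    (LinearMap.range_eq_top.2 (Submodule.mkQ_surjective _)))) (D.Δ h)

def dl : (n : ℕ) → H →ₗ[K] TP K H (n + 1)
  | 0 => t1
  | (n + 1) => t2lift (tm n ∘ₗ dl n) ∘ₗ dd D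

def Ext (n : ℕ) : TP K H 2 →ₗ[K] TP K H (n + 2) := t2lift (tm n ∘ₗ dl D n)

theorem Ext_t2 (n : ℕ) (u v : H) : Ext D n (t2 u v) = tm n (dl D n u) v := t2lift_t2 _ _ _

theorem dl_succ (n : ℕ) (h : H) : dl D (n + 1) h = Ext D n (dd D h) := rfl

theorem mk_dl (n : ℕ) (h : H) : MK (n + 1) (dl D n h) = D.Δpow n h := by
  induction n generalizing h with
  | zero => exact (D.Δpow_zero h).symm
  | succ n ih =>
    obtain ⟨C, uu, vv, e⟩ := t2_sum (dd D h)
    have := D.Δpow_succ n h C uu vv (by rw [← mk_dd, e]; rfl) (fun c => dl D n (uu c))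
      (fun c => ih (uu c))
    rw [this, dl_succ, e, map_sum]
    simp only [Ext_t2]; rfl

theorem coassoc' (x : H) :
    MK 3 (t2lift (tm 1 ∘ₗ dd D) (dd D x)) = MK 3 (t2lift (a3.compl₂ (dd D)) (dd D x)) := by
  obtain ⟨C, uu, vv, e⟩ := t2_sum (dd D x)
  have := D.coassoc x C uu vv (by rw [← mk_dd, e]; rfl) (fun c => dd D (uu c))
    (fun c => dd D (vv c)) (fun c => mk_dd D _) (fun c => mk_dd D _)
  have e1 : t2lift (tm 1 ∘ₗ dd D) (∑ c, t2 (uu c) (vv c)) = ∑ c, tm 1 (dd D (uu c)) (vv c) := by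
    rw [map_sum]; simp only [t2lift_t2]; rfl
  have e2 : t2lift (a3.compl₂ (dd D)) (∑ c, t2 (uu c) (vv c)) =
      ∑ c, a3 (uu c) (dd D (vv c)) := by
    rw [map_sum]; simp only [t2lift_t2]; rfl
  rw [e, e1, e2]
  exact this

structure Good (n : ℕ) : Prop where
  idl : ∀ h, ∀ z ∈ ID (n + 1), dl D n h * z ∈ ID (n + 1)
  mul : ∀ h h', MK (n + 1) (dl D n (h * h')) = MK (n + 1) (dl D n h * dl D n h')
  beta : ∀ r, MK (n + 1) (dl D n (β r)) = MK (n + 1) (slotP K H (n + 1) n (β r))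
  alpha : ∀ r, MK (n + 1) (dl D n (α r)) = MK (n + 1) (slotP K H (n + 1) 0 (α r))
  one : MK (n + 1) (dl D n 1) = MK (n + 1) 1

theorem dd_one : MK 2 (dd D 1) = MK 2 1 := by rw [mk_dd, D.Δ_one]
theorem dd_alpha (r : R) : MK 2 (dd D (α r)) = MK 2 (t2 (α r) 1) := by
  have := D.Δ_bimod_left r 1 1 D.Δ_one.symm
  rw [mul_one, mul_one] at this
  rw [mk_dd, this]; rfl
theorem dd_beta (r : R) : MK 2 (dd D (β r)) = MK 2 (t2 1 (β r)) := by
  have := D.Δ_bimod_right r 1 1 D.Δ_one.symm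
  rw [mul_one, mul_one] at this
  rw [mk_dd, this]; rfl
theorem dd_mul (x y : H) : MK 2 (dd D (x * y)) = MK 2 (dd D x * dd D y) := by
  rw [mk_dd, D.Δ_mul x y _ _ (mk_dd D x) (mk_dd D y)]
theorem dd_compat (x : H) (r : R) :
    dd D x * (t2 (β r) 1 - t2 1 (α r)) ∈ ID 2 := by
  have := D.Δ_compat x r _ (mk_dd D x)
  rw [mk_zero] at this
  exact this

variable {D}
theorem Good.mul_beta {n : ℕ} (g : Good D n) (r : R) (u : H) :
    MK (n + 1) (dl D n (β r * u)) = MK (n + 1) (slotP K H (n + 1) n (β r) * dl D n u) := by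
  rw [g.mul]; exact mk_mul_congr (g.beta r) _
theorem Good.mul_alpha {n : ℕ} (g : Good D n) (r : R) (u : H) :
    MK (n + 1) (dl D n (α r * u)) = MK (n + 1) (slotP K H (n + 1) 0 (α r) * dl D n u) := by
  rw [g.mul]; exact mk_mul_congr (g.alpha r) _

theorem Good.ext_kill {n : ℕ} (g : Good D n) : ∀ z ∈ ID 2, Ext D n z ∈ ID (n + 2) := by
  intro z hz
  refine mk_zero.1 (t2_kill (αf := fun a => α a) (βf := fun a => β a)
    (MK (n + 2) ∘ₗ Ext D n) ?_ z hz)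
  intro r t h
  simp only [LinearMap.comp_apply, Ext_t2]
  rw [mk_tm_congr (g.mul_beta r t) h]
  exact tm_cross n r _ h

theorem Good.ext_congr {n : ℕ} (g : Good D n) {s t : TP K H 2} (h : MK 2 s = MK 2 t) :
    MK (n + 2) (Ext D n s) = MK (n + 2) (Ext D n t) := by
  rw [mk_eq] at h ⊢
  rw [← map_sub]; exact g.ext_kill _ h

theorem Good.ext_mul {n : ℕ} (g : Good D n) (s t : TP K H 2) :
    MK (n + 2) (Ext D n (s * t)) = MK (n + 2) (Ext D n s * Ext D n t) := by
  refine t2_ind (P := fun s => MK (n + 2) (Ext D n (s * t)) = MK (n + 2) (Ext D n s * Ext D n t))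
    (by simp) (fun a b ha hb => by simp only [add_mul, map_add, ha, hb]) ?_ s
  intro u v
  refine t2_ind (P := fun t => MK (n + 2) (Ext D n (t2 u v * t)) =
    MK (n + 2) (Ext D n (t2 u v) * Ext D n t))
    (by simp) (fun a b ha hb => by simp only [mul_add, map_add, ha, hb]) ?_ t
  intro u' v'
  rw [t2_mul, Ext_t2, Ext_t2, Ext_t2, tm_mul]
  exact mk_tm_congr (g.mul u u') _

theorem Good.ext_idl {n : ℕ} (g : Good D n) (s : TP K H 2) (z : TP K H (n + 1))
    (hz : z ∈ ID (n + 1)) (k : H) : Ext D n s * tm n z k ∈ ID (n + 2) := by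
  refine t2_ind (P := fun s => Ext D n s * tm n z k ∈ ID (n + 2)) ?_ ?_ ?_ s
  · rw [map_zero, zero_mul]; exact Submodule.zero_mem _
  · intro a b ha hb; rw [map_add, add_mul]; exact Submodule.add_mem _ ha hb
  · intro u v
    rw [Ext_t2, tm_mul]; exact tm_idl (g.idl u z hz) _

theorem Good.ext_tm {n : ℕ} (g : Good D n) (s : TP K H 2) {x y : TP K H (n + 1)}
    (h : MK (n + 1) x = MK (n + 1) y) (k : H) :
    MK (n + 2) (Ext D n s * tm n x k) = MK (n + 2) (Ext D n s * tm n y k) := by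
  rw [mk_eq] at h ⊢
  rw [← mul_sub, ← LinearMap.sub_apply, ← map_sub]; exact g.ext_idl s _ h k

variable (D) in
theorem good (n : ℕ) : Good D n := by
  induction n with
  | zero =>
    refine ⟨?_, fun _ _ => rfl, fun _ => rfl, fun _ => rfl, rfl⟩
    intro h z hz
    rw [idl_one hz, mul_zero]; exact Submodule.zero_mem _
  | succ n g =>
    refine ⟨?_, ?_, ?_, ?_, ?_⟩
    · intro h z hz
      refine mk_zero.1 (tm_kill (αf := fun a => α a) (βf := fun a => β a)
        (MK (n + 2) ∘ₗ LinearMap.mulLeft K (dl D (n + 1) h)) ?_ ?_ z hz)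
      · intro z hz k
        rw [LinearMap.comp_apply, LinearMap.mulLeft_apply, dl_succ, mk_zero]
        exact g.ext_idl _ z hz k
      · intro r t k
        rw [LinearMap.comp_apply, LinearMap.mulLeft_apply, LinearMap.comp_apply,
          LinearMap.mulLeft_apply, dl_succ]
        have e1 : tm n (slotP K H (n + 1) n (β r) * t) k =
            tm n (slotP K H (n + 1) n (β r)) 1 * tm n t k := by rw [tm_mul, one_mul]
        have e2 : tm n t (α r * k) = tm n 1 (α r) * tm n t k := by rw [tm_mul, one_mul]
        rw [e1, e2, ← mul_assoc, ← mul_assoc]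
        refine mk_mul_congr ?_ _
        rw [g.ext_tm _ (g.beta r).symm, g.ext_tm _ g.one.symm, ← Ext_t2, ← Ext_t2,
          ← g.ext_mul, ← g.ext_mul]
        refine g.ext_congr ?_
        rw [mk_eq, ← mul_sub]
        exact dd_compat D h r
    · intro h h'
      rw [dl_succ, g.ext_congr (dd_mul D h h'), g.ext_mul]; rfl
    · intro r
      rw [dl_succ, g.ext_congr (dd_beta D r), Ext_t2, mk_tm_congr g.one, slot_last]
    · intro r
      rw [dl_succ, g.ext_congr (dd_alpha D r), Ext_t2, mk_tm_congr (g.alpha r),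
        slot_lt (by omega)]
    · rw [dl_succ, g.ext_congr (dd_one D)]
      have e : Ext D n 1 = tm n (dl D n 1) 1 := Ext_t2 D n 1 1
      rw [e, mk_tm_congr g.one]; rfl

theorem catT_congr {n m : ℕ} {x x' : TP K H (n + 1)} {y y' : TP K H (m + 1)}
    (h : MK (n + 1) x = MK (n + 1) x') (h' : MK (m + 1) y = MK (m + 1) y') :
    MK (n + 1 + (m + 1)) (catT n m x y) = MK (n + 1 + (m + 1)) (catT n m x' y') := by
  rw [← catQ_mk, ← catQ_mk, h, h']

variable (D) in
def E2 (n m : ℕ) : TP K H 2 →ₗ[K] TP K H (n + 1 + (m + 1)) :=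
  t2lift ((catT n m).compl₁₂ (dl D n) (dl D m))

variable (D) in
theorem E2_t2 (n m : ℕ) (u v : H) : E2 D n m (t2 u v) = catT n m (dl D n u) (dl D m v) :=
  t2lift_t2 _ _ _

theorem E2_kill (n m : ℕ) : ∀ z ∈ ID 2, E2 D n m z ∈ ID (n + 1 + (m + 1)) := by
  intro z hz
  refine mk_zero.1 (t2_kill (αf := fun a => α a) (βf := fun a => β a)
    (MK (n + 1 + (m + 1)) ∘ₗ E2 D n m) ?_ z hz)
  intro r u v
  simp only [LinearMap.comp_apply, E2_t2]
  rw [catT_congr ((good D n).mul_beta r u) rfl, catT_congr rfl ((good D m).mul_alpha r v)]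
  exact catT_cross n m r _ _

variable (D) in
theorem dl_add (n m : ℕ) (h : H) :
    MK (n + 1 + (m + 1)) (dl D (n + 1 + m) h) = MK (n + 1 + (m + 1)) (E2 D n m (dd D h)) := by
  induction m generalizing h with
  | zero => rfl
  | succ m ih =>
    -- the common map on the triple tensor product
    let G : TP K H 3 →ₗ[K] TP K H (n + 1 + (m + 1 + 1)) :=
      tlift (n := 1) (tm (n + 1 + m) ∘ₗ E2 D n m)
    have hG : ∀ s w, G (tm 1 s w) = tm (n + 1 + m) (E2 D n m s) w := fun s w => tlift_tm _ _ _
    have hG3 : ∀ u t, G (a3 u t) = catT n (m + 1) (dl D n u) (Ext D m t) := by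
      intro u t
      refine t2_ind (P := fun t => G (a3 u t) = catT n (m + 1) (dl D n u) (Ext D m t))
        (by simp only [map_zero]) (fun a b ha hb => by simp only [map_add, ha, hb]) ?_ t
      intro v w
      rw [a3_t2, hG, E2_t2, Ext_t2, catT_tm]
    have hk : ∀ z ∈ ID 3, MK (n + 1 + (m + 1 + 1)) (G z) = 0 := by
      refine tm_kill (αf := fun a => α a) (βf := fun a => β a) (n := 1)
        (MK (n + 1 + (m + 1 + 1)) ∘ₗ G) ?_ ?_
      · intro z hz w
        rw [LinearMap.comp_apply, hG, mk_zero]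
        exact tm_idl (E2_kill n m z hz) w
      · intro r t w
        refine t2_ind (P := fun t => (MK (n + 1 + (m + 1 + 1)) ∘ₗ G)
            (tm 1 (slotP K H (1 + 1) 1 (β r) * t) w) =
          (MK (n + 1 + (m + 1 + 1)) ∘ₗ G) (tm 1 t (α r * w)))
          (by simp) (fun a b ha hb => by simp only [mul_add, map_add, LinearMap.add_apply, ha, hb]) ?_ t
        intro u v
        have e : slotP K H (1 + 1) 1 (β r) * t2 u v = t2 u (β r * v) := by
          have : slotP K H (1 + 1) 1 (β r) = t2 1 (β r) := slot_last 0 (β r)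
          rw [this, t2_mul, one_mul]
        rw [e, ← a3_t2, ← a3_t2, LinearMap.comp_apply, LinearMap.comp_apply, hG3, hG3]
        refine catT_congr rfl ((good D m).ext_congr ?_)
        exact tm_cross 0 r v w
    have l1 : MK (n + 1 + (m + 1 + 1)) (dl D (n + 1 + (m + 1)) h) =
        MK (n + 1 + (m + 1 + 1)) (G (t2lift (tm 1 ∘ₗ dd D) (dd D h))) := by
      have : ∀ s : TP K H 2, MK (n + 1 + (m + 1 + 1)) (Ext D (n + 1 + m) s) =
          MK (n + 1 + (m + 1 + 1)) (G (t2lift (tm 1 ∘ₗ dd D) s)) := by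
        intro s
        refine t2_ind (P := fun s => MK (n + 1 + (m + 1 + 1)) (Ext D (n + 1 + m) s) =
          MK (n + 1 + (m + 1 + 1)) (G (t2lift (tm 1 ∘ₗ dd D) s)))
          (by simp only [map_zero]) (fun a b ha hb => by simp only [map_add]; exact congrArg₂ (· + ·) ha hb) ?_ s
        intro u v
        rw [Ext_t2, t2lift_t2]
        erw [hG]
        exact mk_tm_congr (ih u) v
      exact this (dd D h)
    have l2 : G (t2lift (a3.compl₂ (dd D)) (dd D h)) = E2 D n (m + 1) (dd D h) := by
      refine t2_ind (P := fun s => G (t2lift (a3.compl₂ (dd D)) s) = E2 D n (m + 1) s)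
        (by simp only [map_zero]) (fun a b ha hb => by simp only [map_add, ha, hb]) ?_ (dd D h)
      intro u v
      rw [t2lift_t2, E2_t2, LinearMap.compl₂_apply, hG3]; rfl
    rw [l1, ← l2]
    have := hk _ (mk_eq.1 (coassoc' D h))
    rw [map_sub, map_sub, sub_eq_zero] at this
    exact this

end Hopf
end TwAux

namespace TwAux
section Act
variable {K : Type u} [Field K] [CharZero K] {H : Type u} [Ring H] [Algebra K H]
variable {R : Type u} [Ring R] [Algebra K R]
variable {α : R →ₐ[K] H} {β : R →ₗ[K] H} (D : HopfAlgebroid K H R α β)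

local notation "MK" => qtMk K H (fun a => α a) (fun a => β a)
local notation "ID" => Idl K H (fun a => α a) (fun a => β a)
local notation "PP" => PH K H (fun a => α a) (fun a => β a)
local notation "PC" => phc K (fun a => α a) (fun a => β a)

theorem eps_mul (x y : H) : D.ε (x * α (D.ε y)) = D.ε (x * y) := by
  have h : D.ε (α (D.ε y) - y) = 0 := by
    have := D.ε_bimod_left (D.ε y) 1
    rw [mul_one, D.ε_one, mul_one] at this
    rw [map_sub, this, sub_self]
  have := D.ker_ε_ideal x _ h
  rwa [mul_sub, map_sub, sub_eq_zero] at this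

theorem eps_beta (a : R) : D.ε (β a) = a := by
  have := D.ε_bimod_right a 1
  rwa [mul_one, D.ε_one, one_mul] at this

theorem eps_alpha (a : R) : D.ε (α a) = a := by
  have := D.ε_bimod_left a 1
  rwa [mul_one, D.ε_one, mul_one] at this

def act : (n : ℕ) → H →ₗ[K] PP n →ₗ[K] PP n
  | 0 => (show H →ₗ[K] R →ₗ[K] R from
      ((LinearMap.mul K H).compl₂ α.toLinearMap).compr₂ D.ε)
  | (n + 1) =>
    { toFun := fun h => (ID (n + 1)).mapQ (ID (n + 1)) (LinearMap.mulLeft K (dl D n h))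
        (fun z hz => (good D n).idl h z hz)
      map_add' := by
        intro a b; ext t
        show MK (n + 1) (dl D n (a + b) * t) = MK (n + 1) (dl D n a * t) + MK (n + 1) (dl D n b * t)
        rw [map_add, add_mul, map_add]
      map_smul' := by
        intro c a; ext t
        show MK (n + 1) (dl D n (c • a) * t) = c • MK (n + 1) (dl D n a * t)
        rw [map_smul, Algebra.smul_mul_assoc, map_smul] }

theorem act_zero (h : H) (a : R) : act D 0 h a = D.ε (h * α a) := rfl
theorem act_mk (n : ℕ) (h : H) (t : TP K H (n + 1)) :
    act D (n + 1) h (MK (n + 1) t) = MK (n + 1) (dl D n h * t) := rfl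

theorem act_lift (n : ℕ) (h : H) (s t : TP K H (n + 1)) (hs : MK (n + 1) s = D.Δpow n h) :
    act D (n + 1) h (MK (n + 1) t) = MK (n + 1) (s * t) := by
  rw [act_mk]; refine mk_mul_congr ?_ t
  rw [mk_dl, hs]

theorem act_mul (n : ℕ) (h h' : H) (x : PP n) :
    act D n (h * h') x = act D n h (act D n h' x) := by
  cases n with
  | zero =>
    show D.ε (h * h' * α x) = D.ε (h * α (D.ε (h' * α x)))
    rw [eps_mul, mul_assoc]
  | succ n =>
    obtain ⟨t, rfl⟩ := mk_surj x
    rw [act_mk, act_mk, act_mk, ← mul_assoc]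
    exact mk_mul_congr ((good D n).mul h h') t

theorem act_one (n : ℕ) (x : PP n) : act D n 1 x = x := by
  cases n with
  | zero =>
    show D.ε (1 * α x) = x
    rw [one_mul, eps_alpha]
  | succ n =>
    obtain ⟨t, rfl⟩ := mk_surj x
    rw [act_mk]
    conv_rhs => rw [← one_mul t]
    exact mk_mul_congr (good D n).one t

theorem act_phc {n m : ℕ} (e : n = m) (h : H) (x : PP n) :
    act D m h (PC e x) = PC e (act D n h x) := by
  subst e; rfl

theorem alpha_lin : IsLinearMap K (fun a => α a) := ⟨fun a b => map_add α a b, fun c a => map_smul α c a⟩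
theorem beta_lin : IsLinearMap K (fun a => β a) := ⟨fun a b => map_add β a b, fun c a => map_smul β c a⟩

def cc : ∀ n m : ℕ, PP n →ₗ[K] PP m →ₗ[K] PP (n + m) :=
  conc (alpha_lin) (beta_lin) D.αβ_comm (LinearMap.mul K R)

theorem cc_ss (n m : ℕ) (x : TP K H (n + 1)) (y : TP K H (m + 1)) :
    cc D (n + 1) (m + 1) (MK (n + 1) x) (MK (m + 1) y) =
      MK (n + 1 + (m + 1)) (catT n m x y) := rfl

theorem cc_phc_left {n n' m : ℕ} (e : n = n') (x : PP n) (y : PP m) :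
    cc D n' m (PC e x) y = PC (show n + m = n' + m by rw [e]) (cc D n m x y) := by
  subst e; rfl
theorem cc_phc_right {n m m' : ℕ} (e : m = m') (x : PP n) (y : PP m) :
    cc D n m' x (PC e y) = PC (show n + m = n + m' by rw [e]) (cc D n m x y) := by
  subst e; rfl

theorem cc_left (m : ℕ) (a : R) (y : PP m) :
    cc D 0 m a y = PC (zadd_eq m) (act D m (α a) y) := by
  cases m with
  | zero =>
    show a * y = D.ε (α a * α y)
    rw [← map_mul, eps_alpha]
  | succ m =>
    obtain ⟨t, rfl⟩ := mk_surj y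
    rw [act_mk, mk_mul_congr ((good D m).alpha a)]
    rfl

theorem cc_right (n : ℕ) (x : PP n) (a : R) :
    cc D n 0 x a = act D n (β a) x := by
  cases n with
  | zero =>
    show x * a = D.ε (β a * α x)
    rw [D.ε_bimod_right, eps_alpha]
  | succ n =>
    obtain ⟨t, rfl⟩ := mk_surj x
    rw [act_mk, mk_mul_congr ((good D n).beta a)]
    rfl

theorem cc_cross (n m : ℕ) (r : R) (x : PP n) (y : PP m) :
    cc D n m (act D n (β r) x) y = cc D n m x (act D m (α r) y) := by
  cases n with
  | zero =>
    have e : act D 0 (β r) x = (x * r : R) := by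
      rw [act_zero, D.ε_bimod_right, eps_alpha]
    rw [e, cc_left, cc_left, ← act_mul, ← map_mul α]
  | succ n =>
    cases m with
    | zero =>
      have e : act D 0 (α r) y = (r * y : R) := by
        rw [act_zero, D.ε_bimod_left, eps_alpha]
      rw [e, cc_right, cc_right, ← act_mul, D.β_mul]
    | succ m =>
      obtain ⟨s, rfl⟩ := mk_surj x
      obtain ⟨t, rfl⟩ := mk_surj y
      rw [act_mk, mk_mul_congr ((good D n).beta r), act_mk, mk_mul_congr ((good D m).alpha r),
        cc_ss, cc_ss]
      exact catT_cross n m r s t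

def C2 (n m : ℕ) (x : PP n) (y : PP m) : TP K H 2 →ₗ[K] PP (n + m) :=
  t2lift ((cc D n m).compl₁₂ ((act D n).flip x) ((act D m).flip y))

theorem C2_t2 (n m : ℕ) (x : PP n) (y : PP m) (u v : H) :
    C2 D n m x y (t2 u v) = cc D n m (act D n u x) (act D m v y) := t2lift_t2 _ _ _

theorem C2_kill (n m : ℕ) (x : PP n) (y : PP m) : ∀ z ∈ ID 2, C2 D n m x y z = 0 := by
  refine t2_kill (αf := fun a => α a) (βf := fun a => β a) _ ?_
  intro r u v
  rw [C2_t2, C2_t2, act_mul, act_mul, cc_cross]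

def L1 : TP K H 2 →ₗ[K] H := t2lift ((LinearMap.mul K H).comp (α.toLinearMap ∘ₗ D.ε))
def L2 : TP K H 2 →ₗ[K] H := t2lift ((LinearMap.mul K H).comp (β ∘ₗ D.ε)).flip
theorem L1_t2 (u v : H) : L1 D (t2 u v) = α (D.ε u) * v := t2lift_t2 _ _ _
theorem L2_t2 (u v : H) : L2 D (t2 u v) = β (D.ε v) * u := t2lift_t2 _ _ _

theorem L1_eq (h : H) (s : TP K H 2) (hs : MK 2 s = D.Δ h) : L1 D s = h := by
  obtain ⟨C, uu, vv, rfl⟩ := t2_sum s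
  rw [map_sum]; simp only [L1_t2]
  exact D.counit_left h C uu vv hs
theorem L2_eq (h : H) (s : TP K H 2) (hs : MK 2 s = D.Δ h) : L2 D s = h := by
  obtain ⟨C, uu, vv, rfl⟩ := t2_sum s
  rw [map_sum]; simp only [L2_t2]
  exact D.counit_right h C uu vv hs

theorem C2_eq (n m : ℕ) (x : PP n) (y : PP m) (h : H) (s : TP K H 2) (hs : MK 2 s = D.Δ h) :
    C2 D n m x y s = act D (n + m) h (cc D n m x y) := by
  cases n with
  | zero =>
    have key : ∀ s, C2 D 0 m x y s = PC (zadd_eq m) (act D m (L1 D (s * t2 (α x) 1)) y) := by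
      intro s
      refine t2_ind (P := fun s => C2 D 0 m x y s =
        PC (zadd_eq m) (act D m (L1 D (s * t2 (α x) 1)) y)) ?_ ?_ ?_ s
      · simp only [zero_mul, map_zero, LinearMap.zero_apply]
      · intro a b ha hb; simp only [add_mul, map_add, LinearMap.add_apply, ha, hb]
      · intro u v
        rw [C2_t2, t2_mul, L1_t2, mul_one, cc_left, act_mul]; rfl
    rw [key, cc_left, act_phc, ← act_mul, L1_eq D (h * α x)]
    refine (D.Δ_mul h (α x) s (t2 (α x) 1) hs ?_).symm
    rw [← dd_alpha D, mk_dd]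
  | succ n =>
    cases m with
    | zero =>
      have key : ∀ s, C2 D (n + 1) 0 x y s = act D (n + 1) (L2 D (s * t2 1 (β y))) x := by
        intro s
        refine t2_ind (P := fun s => C2 D (n + 1) 0 x y s =
          act D (n + 1) (L2 D (s * t2 1 (β y))) x) ?_ ?_ ?_ s
        · simp only [zero_mul, map_zero, LinearMap.zero_apply]
        · intro a b ha hb; simp only [add_mul, map_add, LinearMap.add_apply, ha, hb]
        · intro u v
          rw [C2_t2, t2_mul, L2_t2, mul_one, cc_right, act_mul, ← eps_mul, eps_beta]; rfl
      rw [key, cc_right]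
      refine Eq.trans ?_ (act_mul D (n + 1) h (β y) x)
      rw [L2_eq D (h * β y)]
      refine (D.Δ_mul h (β y) s (t2 1 (β y)) hs ?_).symm
      rw [← dd_beta D, mk_dd]
    | succ m =>
      have e : C2 D (n + 1) (m + 1) x y s = C2 D (n + 1) (m + 1) x y (dd D h) := by
        rw [← sub_eq_zero, ← map_sub]
        refine C2_kill D _ _ x y _ (mk_eq.1 ?_)
        rw [hs, mk_dd]
      rw [e]
      obtain ⟨t, rfl⟩ := mk_surj x
      obtain ⟨t', rfl⟩ := mk_surj y
      rw [cc_ss]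
      have e2 : act D (n + 1 + (m + 1)) h (MK (n + 1 + (m + 1)) (catT n m t t')) =
          MK (n + 1 + (m + 1)) (E2 D n m (dd D h) * catT n m t t') :=
        mk_mul_congr (dl_add D n m h) _
      rw [e2]
      refine t2_ind (P := fun s => C2 D (n + 1) (m + 1) (MK (n + 1) t) (MK (m + 1) t') s =
        MK (n + 1 + (m + 1)) (E2 D n m s * catT n m t t')) ?_ ?_ ?_ (dd D h)
      · simp only [zero_mul, map_zero]
      · intro a b ha hb; simp only [add_mul, map_add, ha, hb]
      · intro u v
        rw [C2_t2, act_mk, act_mk, cc_ss, E2_t2, catT_mul]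

theorem act_alpha_cc (n m : ℕ) (x : PP n) (y : PP m) (a : R) :
    act D (n + m) (α a) (cc D n m x y) = cc D n m (act D n (α a) x) y := by
  rw [← C2_eq D n m x y (α a) (t2 (α a) 1) (by rw [← dd_alpha D, mk_dd]), C2_t2, act_one]

theorem act_beta_cc (n m : ℕ) (x : PP n) (y : PP m) (a : R) :
    act D (n + m) (β a) (cc D n m x y) = cc D n m x (act D m (β a) y) := by
  rw [← C2_eq D n m x y (β a) (t2 1 (β a)) (by rw [← dd_beta D, mk_dd]), C2_t2, act_one]

theorem cc_assoc (n m l : ℕ) (x : PP n) (y : PP m) (z : PP l) :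
    PC (show n + m + l = n + (m + l) by omega) (cc D (n + m) l (cc D n m x y) z) = cc D n (m + l) x (cc D m l y z) := by
  cases n with
  | zero =>
    rw [cc_left, cc_left, act_alpha_cc, cc_phc_left, phc_phc]
  | succ n =>
    cases m with
    | zero =>
      rw [cc_left, cc_right, cc_phc_right]
      exact congrArg _ (cc_cross D (n + 1) l y x z)
    | succ m =>
      cases l with
      | zero =>
        rw [cc_right, cc_right, act_beta_cc]; rfl
      | succ l =>
        obtain ⟨s, rfl⟩ := mk_surj x
        obtain ⟨t, rfl⟩ := mk_surj y
        obtain ⟨w, rfl⟩ := mk_surj z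
        rw [cc_ss, cc_ss]
        refine Eq.trans (phc_mk _ _) ?_
        refine congrArg (MK _) (catT_assoc n m l s t w)

end Act
end TwAux

namespace TwAux
section Star
variable {K : Type u} [Field K] [CharZero K] {H : Type u} [Ring H] [Algebra K H]
variable {R : Type u} [Ring R] [Algebra K R]
variable {α : R →ₐ[K] H} {β : R →ₗ[K] H} (D : HopfAlgebroid K H R α β)
variable {C : ℕ} (p q : Fin C → H)

local notation "MK" => qtMk K H (fun a => α a) (fun a => β a)
local notation "ID" => Idl K H (fun a => α a) (fun a => β a)
local notation "PP" => PH K H (fun a => α a) (fun a => β a)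
local notation "PC" => phc K (fun a => α a) (fun a => β a)

def st (n m : ℕ) : PP n →ₗ[K] PP m →ₗ[K] PP (n + m) :=
  ∑ c, (cc D n m).compl₁₂ (act D n (p c)) (act D m (q c))

theorem st_apply (n m : ℕ) (x : PP n) (y : PP m) :
    st D p q n m x y = ∑ c, cc D n m (act D n (p c) x) (act D m (q c) y) := by
  unfold st
  rw [LinearMap.sum_apply, LinearMap.sum_apply]; rfl

def Th (n m l : ℕ) (x : PP n) (y : PP m) (z : PP l) : TP K H 3 →ₗ[K] PP (n + m + l) :=
  tlift (n := 1) ((cc D (n + m) l).compl₁₂ (C2 D n m x y) ((act D l).flip z))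

theorem Th_tm (n m l : ℕ) (x : PP n) (y : PP m) (z : PP l) (t : TP K H 2) (w : H) :
    Th D n m l x y z (tm 1 t w) = cc D (n + m) l (C2 D n m x y t) (act D l w z) :=
  tlift_tm _ _ _

theorem Th_kill (n m l : ℕ) (x : PP n) (y : PP m) (z : PP l) :
    ∀ w ∈ ID 3, Th D n m l x y z w = 0 := by
  refine tm_kill (n := 1) (αf := fun a => α a) (βf := fun a => β a) _ ?_ ?_
  · intro w hw h
    rw [Th_tm, C2_kill D n m x y w hw, map_zero, LinearMap.zero_apply]
  · intro r t h
    rw [Th_tm, Th_tm]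
    refine t2_ind (P := fun t => cc D (n + m) l (C2 D n m x y (slotP K H (1 + 1) 1 (β r) * t))
      (act D l h z) = cc D (n + m) l (C2 D n m x y t) (act D l (α r * h) z)) ?_ ?_ ?_ t
    · simp only [mul_zero, map_zero, LinearMap.zero_apply]
    · intro a b ha hb
      simp only [mul_add, map_add, LinearMap.add_apply, ha, hb]
    · intro u v
      have e : slotP K H (1 + 1) 1 (β r) * t2 u v = t2 u (β r * v) := by
        refine (congrArg (· * t2 u v) (slot_last 0 (β r))).trans ?_
        refine (tm_mul 0 _ _ _ _).trans ?_
        exact congrArg (fun w => (tm 0 w (β r * v) : TP K H 2)) (one_mul (t1 u))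
      rw [e, C2_t2, C2_t2, act_mul, act_mul, ← act_beta_cc, cc_cross]

theorem Th_left (n m l : ℕ) (x : PP n) (y : PP m) (z : PP l) (s : TP K H 2) (p' q' k : H) :
    Th D n m l x y z (tm 1 (s * t2 p' q') k) =
      cc D (n + m) l (C2 D n m (act D n p' x) (act D m q' y) s) (act D l k z) := by
  rw [Th_tm]
  congr 2
  refine t2_ind (P := fun s => C2 D n m x y (s * t2 p' q') =
    C2 D n m (act D n p' x) (act D m q' y) s) ?_ ?_ ?_ s
  · simp only [zero_mul, map_zero]
  · intro a b ha hb
    simp only [add_mul, map_add, ha, hb]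
  · intro u v
    rw [t2_mul, C2_t2, C2_t2, act_mul, act_mul]

theorem Th_right (n m l : ℕ) (x : PP n) (y : PP m) (z : PP l) (t : TP K H 2) (u p' q' : H) :
    PC (show n + m + l = n + (m + l) by omega)
      (Th D n m l x y z (a3 u t * a3 1 (t2 p' q'))) =
      cc D n (m + l) (act D n u x) (C2 D m l (act D m p' y) (act D l q' z) t) := by
  refine t2_ind (P := fun t => PC (show n + m + l = n + (m + l) by omega)
      (Th D n m l x y z (a3 u t * a3 1 (t2 p' q'))) =
      cc D n (m + l) (act D n u x) (C2 D m l (act D m p' y) (act D l q' z) t)) ?_ ?_ ?_ t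
  · simp only [zero_mul, map_zero]
  · intro a b ha hb
    simp only [add_mul, map_add, ha, hb]
  · intro v w
    have e : (a3 u (t2 v w) * a3 1 (t2 p' q') : TP K H 3) = tm 1 (t2 u (v * p')) (w * q') := by
      rw [a3_t2, a3_t2]
      refine (tm_mul 1 _ _ _ _).trans ?_
      refine (congrArg (fun s => tm 1 s (w * q')) (t2_mul u 1 v p')).trans ?_
      rw [mul_one]
    rw [e, Th_tm, C2_t2, C2_t2, cc_assoc, act_mul, act_mul]

variable {p q}
theorem st_assoc (htw : IsTwistor D p q) (n m l : ℕ) (x : PP n) (y : PP m) (z : PP l) :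
    PC (show n + m + l = n + (m + l) by omega)
      (st D p q (n + m) l (st D p q n m x y) z) =
      st D p q n (m + l) x (st D p q m l y z) := by
  obtain ⟨⟨s, t, hs, ht, hT⟩, -, -⟩ := htw
  have h1 : Th D n m l x y z ((∑ c, tm 1 (s c) (q c)) * (∑ c, tm 1 (t2 (p c) (q c)) 1)) =
      st D p q (n + m) l (st D p q n m x y) z := by
    rw [Finset.sum_mul_sum, map_sum, st_apply]
    refine Finset.sum_congr rfl fun c _ => ?_
    rw [map_sum, st_apply, map_sum, map_sum, LinearMap.sum_apply]
    refine Finset.sum_congr rfl fun c' _ => ?_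
    have e : tm 1 (s c) (q c) * tm 1 (t2 (p c') (q c')) 1 = tm 1 (s c * t2 (p c') (q c')) (q c) := by
      refine (tm_mul 1 _ _ _ _).trans ?_
      rw [mul_one]
    rw [e, Th_left, C2_eq D n m _ _ (p c) (s c) (hs c)]
  have h2 : PC (show n + m + l = n + (m + l) by omega)
      (Th D n m l x y z ((∑ c, a3 (p c) (t c)) * (∑ c, a3 1 (t2 (p c) (q c))))) =
      st D p q n (m + l) x (st D p q m l y z) := by
    rw [Finset.sum_mul_sum, map_sum, map_sum, st_apply]
    refine Finset.sum_congr rfl fun c _ => ?_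
    rw [map_sum, map_sum, st_apply, map_sum, map_sum]
    refine Finset.sum_congr rfl fun c' _ => ?_
    rw [Th_right, C2_eq D m l _ _ (q c) (t c) (ht c)]
  rw [← h1, ← h2]
  congr 1
  rw [← sub_eq_zero, ← map_sub]
  exact Th_kill D n m l x y z _ (mk_eq.1 hT)

variable (p q)
theorem st_left (m : ℕ) (a : R) (y : PP m) :
    st D p q 0 m a y = PC (zadd_eq m) (act D m (alphaF D p q a) y) := by
  rw [st_apply]; unfold alphaF
  rw [map_sum, LinearMap.sum_apply, map_sum]
  refine Finset.sum_congr rfl fun c _ => ?_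
  rw [act_mul]
  exact cc_left D m _ _

theorem st_right (n : ℕ) (x : PP n) (a : R) :
    st D p q n 0 x a = act D n (betaF D p q a) x := by
  rw [st_apply]; unfold betaF
  rw [map_sum, LinearMap.sum_apply]
  refine Finset.sum_congr rfl fun c _ => ?_
  rw [act_mul]
  exact cc_right D n _ _

theorem st_zero (a b : R) : st D p q 0 0 a b = starF D p q a b := by
  rw [st_apply]; rfl

variable {p q}
theorem alphaF_one (htw : IsTwistor D p q) : alphaF D p q 1 = 1 := by
  obtain ⟨-, h, -⟩ := htw
  refine Eq.trans ?_ h.1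
  unfold alphaF HopfAlgebroid.hAct
  simp only [map_one, mul_one]
theorem betaF_one (htw : IsTwistor D p q) : betaF D p q 1 = 1 := by
  obtain ⟨-, h, -⟩ := htw
  refine Eq.trans ?_ h.2
  unfold betaF HopfAlgebroid.hAct
  simp only [map_one, mul_one]

theorem st_one_left (htw : IsTwistor D p q) (m : ℕ) (y : PP m) :
    st D p q 0 m (1 : R) y = PC (zadd_eq m) y := by
  rw [st_left, alphaF_one D htw, act_one]
theorem st_one_right (htw : IsTwistor D p q) (n : ℕ) (x : PP n) :
    st D p q n 0 x (1 : R) = x := by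
  rw [st_right, betaF_one D htw, act_one]

theorem st_cross (htw : IsTwistor D p q) (n m : ℕ) (r : R) (x : PP n) (y : PP m) :
    st D p q n m (act D n (betaF D p q r) x) y = st D p q n m x (act D m (alphaF D p q r) y) := by
  have h := st_assoc D htw n 0 m x r y
  rw [st_right, st_left] at h
  have h2 : ∀ (k : ℕ) (e : m = k) (e' : n + m = n + k) (w : PP m),
      st D p q n k x (PC e w) = PC e' (st D p q n m x w) := by
    intro k e e' w; subst e; rfl
  rw [h2 (0 + m) (by omega) (by omega)] at h
  have inj : Function.Injective (PC (show n + 0 + m = n + (0 + m) by omega)) := by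
    have : ∀ (a b : ℕ) (e : a = b), Function.Injective (PC e) := by
      intro a b e; subst e; exact fun x y h => h
    exact this _ _ _
  exact inj h

theorem act_mk1 (h k : H) : act D 1 h (MK 1 (t1 k)) = MK 1 (t1 (h * k)) := rfl
theorem mk1_inj {h k : H} (e : MK 1 (t1 h) = MK 1 (t1 k)) : h = k := by
  have := idl_one (mk_eq.1 e)
  exact sub_eq_zero.1 this

theorem st_phc_left {n n' m : ℕ} (e : n = n') (x : PP n) (y : PP m) :
    st D p q n' m (PC e x) y = PC (show n + m = n' + m by rw [e]) (st D p q n m x y) := by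
  subst e; rfl
theorem st_phc_right {n m m' : ℕ} (e : m = m') (x : PP n) (y : PP m) :
    st D p q n m' x (PC e y) = PC (show n + m = n + m' by rw [e]) (st D p q n m x y) := by
  subst e; rfl

theorem alphaF_betaF (htw : IsTwistor D p q) (a b : R) :
    alphaF D p q a * betaF D p q b = betaF D p q b * alphaF D p q a := by
  have h := st_assoc D htw 0 1 0 a (MK 1 (t1 1)) b
  rw [st_left, st_left, st_right, st_right, act_phc, phc_phc] at h
  have h' : act D 1 (betaF D p q b) (act D 1 (alphaF D p q a) (MK 1 (t1 1))) =
      act D 1 (alphaF D p q a) (act D 1 (betaF D p q b) (MK 1 (t1 1))) := h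
  rw [act_mk1, act_mk1, act_mk1, act_mk1] at h'
  have := mk1_inj h'
  rw [mul_one, mul_one] at this
  exact this.symm

variable (p q)
theorem alphaF_lin : IsLinearMap K (alphaF D p q) := by
  unfold alphaF HopfAlgebroid.hAct
  constructor
  · intro a b; simp only [map_add, mul_add, add_mul, Finset.sum_add_distrib]
  · intro c a; simp only [map_smul, Algebra.mul_smul_comm, Algebra.smul_mul_assoc, Finset.smul_sum]
theorem betaF_lin : IsLinearMap K (betaF D p q) := by
  unfold betaF HopfAlgebroid.hAct
  constructor
  · intro a b; simp only [map_add, mul_add, add_mul, Finset.sum_add_distrib]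
  · intro c a; simp only [map_smul, Algebra.mul_smul_comm, Algebra.smul_mul_assoc, Finset.smul_sum]

end Star
end TwAux

namespace TwAux
section Sharp
variable {K : Type u} [Field K] [CharZero K] {H : Type u} [Ring H] [Algebra K H]
variable {R : Type u} [Ring R] [Algebra K R]
variable {α : R →ₐ[K] H} {β : R →ₗ[K] H} (D : HopfAlgebroid K H R α β)
variable {C : ℕ} (p q : Fin C → H)

local notation "MK" => qtMk K H (fun a => α a) (fun a => β a)
local notation "MF" => qtMk K H (alphaF D p q) (betaF D p q)
local notation "ID" => Idl K H (fun a => α a) (fun a => β a)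
local notation "PP" => PH K H (fun a => α a) (fun a => β a)
local notation "PF" => PH K H (alphaF D p q) (betaF D p q)
local notation "PC" => phc K (fun a => α a) (fun a => β a)

def fs : (n : ℕ) → TP K H (n + 1) →ₗ[K] PP (n + 1)
  | 0 => MK 1
  | (n + 1) => tlift ((st D p q (n + 1) 1).compl₁₂ (fs n) (MK 1 ∘ₗ t1))

theorem fs_zero (h : H) : fs D p q 0 (t1 h) = MK 1 (t1 h) := rfl
theorem fs_tm (n : ℕ) (t : TP K H (n + 1)) (h : H) :
    fs D p q (n + 1) (tm n t h) = st D p q (n + 1) 1 (fs D p q n t) (MK 1 (t1 h)) :=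
  tlift_tm _ _ _

def ee : (n : ℕ) → TP K H n
  | 0 => 1
  | 1 => 1
  | (n + 2) => (∑ c, tm n (dl D n (p c)) (q c)) * tm n (ee (n + 1)) 1

theorem ee_succ (n : ℕ) : ee D p q (n + 2) =
    (∑ c, tm n (dl D n (p c)) (q c)) * tm n (ee D p q (n + 1)) 1 := rfl

theorem st_mk1 (n : ℕ) (t : TP K H (n + 1)) (h : H) :
    st D p q (n + 1) 1 (MK (n + 1) t) (MK 1 (t1 h)) =
      MK (n + 2) ((∑ c, tm n (dl D n (p c)) (q c)) * tm n t h) := by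
  rw [st_apply, Finset.sum_mul, map_sum]
  refine Finset.sum_congr rfl fun c _ => ?_
  rw [act_mk, act_mk1, tm_mul]
  rfl

theorem fs_eq (n : ℕ) (t : TP K H (n + 1)) :
    fs D p q n t = MK (n + 1) (ee D p q (n + 1) * t) := by
  induction n with
  | zero => exact (congrArg (MK 1) (one_mul (t : TP K H 1))).symm
  | succ n ih =>
    refine tp_ind (P := fun t => fs D p q (n + 1) t =
      MK (n + 2) (ee D p q (n + 2) * t)) ?_ ?_ ?_ t
    · simp only [mul_zero, map_zero]
    · intro a b ha hb; simp only [mul_add, map_add, ha, hb]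
    · intro x h
      rw [fs_tm, ih, st_mk1, ee_succ, mul_assoc, tm_mul, one_mul]

variable {p q}
theorem act_betaF_st (htw : IsTwistor D p q) (n m : ℕ) (a : R) (x : PP n) (y : PP m) :
    act D (n + m) (betaF D p q a) (st D p q n m x y) =
      st D p q n m x (act D m (betaF D p q a) y) := by
  rw [← st_right D p q (n + m), ← st_right D p q m]
  exact st_assoc D htw n m 0 x y a

theorem phc_inj {a b : ℕ} (e : a = b) {x y : PP a} (h : PC e x = PC e y) : x = y := by
  subst e; exact h

theorem act_alphaF_st (htw : IsTwistor D p q) (n m : ℕ) (a : R) (x : PP n) (y : PP m) :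
    act D (n + m) (alphaF D p q a) (st D p q n m x y) =
      st D p q n m (act D n (alphaF D p q a) x) y := by
  have h := st_assoc D htw 0 n m a x y
  rw [st_left, st_left, st_phc_left, phc_phc] at h
  exact (phc_inj _ h).symm

theorem fs_beta (htw : IsTwistor D p q) (n : ℕ) (a : R) (t : TP K H (n + 1)) :
    fs D p q n (slotP K H (n + 1) n (betaF D p q a) * t) =
      act D (n + 1) (betaF D p q a) (fs D p q n t) := by
  cases n with
  | zero => rfl
  | succ n =>
    refine tp_ind (P := fun t => fs D p q (n + 1) (slotP K H (n + 2) (n + 1) (betaF D p q a) * t) =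
      act D (n + 1 + 1) (betaF D p q a) (fs D p q (n + 1) t)) ?_ ?_ ?_ t
    · simp only [mul_zero, map_zero]
    · intro x y hx hy; simp only [mul_add, map_add, hx, hy]
    · intro x h
      rw [slot_last, tm_mul, one_mul, fs_tm, fs_tm, act_betaF_st D htw, act_mk1]

theorem fs_alpha (htw : IsTwistor D p q) (n : ℕ) (a : R) (t : TP K H (n + 1)) :
    fs D p q n (slotP K H (n + 1) 0 (alphaF D p q a) * t) =
      act D (n + 1) (alphaF D p q a) (fs D p q n t) := by
  induction n with
  | zero => rfl
  | succ n ih =>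
    refine tp_ind (P := fun t => fs D p q (n + 1) (slotP K H (n + 2) 0 (alphaF D p q a) * t) =
      act D (n + 1 + 1) (alphaF D p q a) (fs D p q (n + 1) t)) ?_ ?_ ?_ t
    · simp only [mul_zero, map_zero]
    · intro x y hx hy; simp only [mul_add, map_add, hx, hy]
    · intro x h
      rw [slot_lt (by omega), tm_mul, one_mul, fs_tm, fs_tm, act_alphaF_st D htw, ih]

theorem fs_kill (htw : IsTwistor D p q) (n : ℕ) :
    ∀ z ∈ Idl K H (alphaF D p q) (betaF D p q) (n + 1), fs D p q n z = 0 := by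
  induction n with
  | zero => intro z hz; rw [idl_one hz, map_zero]
  | succ n ih =>
    refine tm_kill (αf := alphaF D p q) (βf := betaF D p q) _ ?_ ?_
    · intro z hz h
      rw [fs_tm, ih z hz, map_zero, LinearMap.zero_apply]
    · intro r t h
      rw [fs_tm, fs_tm, fs_beta D htw, st_cross D htw, act_mk1]

theorem fs_cat (htw : IsTwistor D p q) (n m : ℕ) (t : TP K H (n + 1)) (s : TP K H (m + 1)) :
    fs D p q (n + 1 + m) (catT n m t s) =
      st D p q (n + 1) (m + 1) (fs D p q n t) (fs D p q m s) := by
  induction m with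
  | zero => exact fs_tm D p q n t s
  | succ m ih =>
    refine tp_ind (P := fun s => fs D p q (n + 1 + (m + 1)) (catT n (m + 1) t s) =
      st D p q (n + 1) (m + 1 + 1) (fs D p q n t) (fs D p q (m + 1) s)) ?_ ?_ ?_ s
    · simp only [map_zero]
    · intro a b ha hb; simp only [map_add, ha, hb]
    · intro x h
      rw [catT_tm, fs_tm D p q m]
      refine (fs_tm D p q (n + 1 + m) _ h).trans ?_
      rw [ih]
      exact st_assoc D htw (n + 1) (m + 1) 1 _ _ _

def FS (htw : IsTwistor D p q) : (n : ℕ) → PF n →ₗ[K] PP n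
  | 0 => (LinearMap.id : R →ₗ[K] R)
  | (n + 1) => (Idl K H (alphaF D p q) (betaF D p q) (n + 1)).liftQ (fs D p q n) (fs_kill D htw n)

theorem FS_zero (htw : IsTwistor D p q) (a : R) : FS D htw 0 a = a := rfl
theorem FS_mk (htw : IsTwistor D p q) (n : ℕ) (t : TP K H (n + 1)) :
    FS D htw (n + 1) (MF (n + 1) t) = fs D p q n t := rfl

theorem FS_phc (htw : IsTwistor D p q) {a b : ℕ} (e : a = b) (x : PF a) :
    FS D htw b (phc K (alphaF D p q) (betaF D p q) e x) = PC e (FS D htw a x) := by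
  subst e; rfl

def mulF : R →ₗ[K] R →ₗ[K] R := st D p q 0 0

def cat (htw : IsTwistor D p q) : ∀ n m : ℕ, PF n →ₗ[K] PF m →ₗ[K] PF (n + m) :=
  conc (alphaF_lin D p q) (betaF_lin D p q) (alphaF_betaF D htw) (mulF D (p := p) (q := q))

theorem FS_cat (htw : IsTwistor D p q) (n m : ℕ) (x : PF n) (y : PF m) :
    FS D htw (n + m) (cat D htw n m x y) = st D p q n m (FS D htw n x) (FS D htw m y) := by
  cases n with
  | zero =>
    cases m with
    | zero => rfl
    | succ m =>
      obtain ⟨t, rfl⟩ := mk_surj y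
      refine (FS_phc D htw _ _).trans ?_
      rw [FS_mk]
      refine Eq.trans ?_ (st_left D p q (m + 1) x _).symm
      exact congrArg _ (fs_alpha D htw m x t)
  | succ n =>
    obtain ⟨t, rfl⟩ := mk_surj x
    cases m with
    | zero =>
      rw [FS_mk]
      exact (fs_beta D htw n y t).trans (st_right D p q (n + 1) _ y).symm
    | succ m =>
      obtain ⟨s, rfl⟩ := mk_surj y
      exact fs_cat D htw n m t s

end Sharp

section Signs
variable (K : Type u) [Field K]
theorem sgn_add (a b : ℤ) : sgn K (a + b) = sgn K a * sgn K b := by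
  unfold sgn; rw [zpow_add, Units.val_mul]
theorem sgn_zero : sgn K 0 = 1 := by unfold sgn; simp
theorem sgn_two (a b : ℤ) : sgn K (a + 2 * b) = sgn K a := by
  rw [sgn_add]; unfold sgn
  rw [zpow_mul]; simp
end Signs
end TwAux

namespace TwAux
section Final
variable {K : Type u} [Field K] [CharZero K] {H : Type u} [Ring H] [Algebra K H]
variable {R : Type u} [Ring R] [Algebra K R]
variable {α : R →ₐ[K] H} {β : R →ₗ[K] H} (D : HopfAlgebroid K H R α β)
variable {C : ℕ} (p q : Fin C → H)

local notation "MK" => qtMk K H (fun a => α a) (fun a => β a)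
local notation "MF" => qtMk K H (alphaF D p q) (betaF D p q)
local notation "PP" => PH K H (fun a => α a) (fun a => β a)
local notation "PF" => PH K H (alphaF D p q) (betaF D p q)
local notation "PC" => phc K (fun a => α a) (fun a => β a)

def FB (n m : ℕ) : PP n →ₗ[K] PP m →ₗ[K] PP (n + m) :=
  sgn K ((n : ℤ) * m + n) • st D p q n m

theorem FB_apply (n m : ℕ) (x : PP n) (y : PP m) :
    FB D p q n m x y = sgn K ((n : ℤ) * m + n) • st D p q n m x y := rfl

theorem FB_cup (n m : ℕ) (x : PP n) (y : PP m) :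
    sgn K (n : ℤ) • FB D p q n m x y = sgn K ((n : ℤ) * m) • st D p q n m x y := by
  rw [FB_apply, smul_smul, ← sgn_add]
  congr 1
  rw [← sgn_two K ((n : ℤ) * m) n]; congr 1; ring

theorem act_chains (n : ℕ) (h : H) (x : Fin (n + 1) → H) (N : ℕ) (Z : Fin N → Fin (n + 1) → H)
    (hZ : MK (n + 1) (∑ d, chainP K H (n + 1) (Z d)) = D.Δpow n h) :
    act D (n + 1) h (MK (n + 1) (chainP K H (n + 1) x)) =
      MK (n + 1) (∑ d, chainP K H (n + 1) (fun t => Z d t * x t)) := by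
  rw [act_lift D n h _ _ hZ, Finset.sum_mul]
  simp only [chain_mul]

theorem FB_brace : IsFBrace D p q (FB D p q) := by
  refine ⟨?_, ?_, ?_, ?_⟩
  · intro n m x y CP CQ ZP ZQ hP hQ
    refine (FB_apply D p q _ _ _ _).trans ?_
    have es : sgn K (((n + 1 : ℕ) : ℤ) * ((m + 1 : ℕ) : ℤ) + ((n + 1 : ℕ) : ℤ)) =
        sgn K (((n : ℤ) + 1) * (m : ℤ)) := by
      rw [← sgn_two K (((n : ℤ) + 1) * (m : ℤ)) (n + 1)]; congr 1; push_cast; ring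
    rw [es]
    refine congrArg (fun w => sgn K (((n : ℤ) + 1) * (m : ℤ)) • w) ?_
    refine (st_apply D p q _ _ _ _).trans ?_
    refine Eq.trans ?_ (map_sum (MK (n + 1 + (m + 1))) _ _).symm
    refine Finset.sum_congr rfl fun c _ => ?_
    have h1 := act_chains D n (p c) x _ (ZP c) (hP c)
    have h2 := act_chains D m (q c) y _ (ZQ c) (hQ c)
    refine (congrArg₂ (fun a b => cc D (n + 1) (m + 1) a b) h1 h2).trans ?_
    refine (cc_ss D n m _ _).trans ?_
    refine congrArg (MK (n + 1 + (m + 1))) ?_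
    rw [map_sum (catT n m), LinearMap.sum_apply]
    refine Finset.sum_congr rfl fun d _ => ?_
    rw [map_sum]
    refine Finset.sum_congr rfl fun d' _ => ?_
    exact chain_append n m _ _
  · intro m a y CA ZA hA
    refine (FB_apply D p q _ _ _ _).trans ?_
    have es : sgn K (((0 : ℕ) : ℤ) * ((m + 1 : ℕ) : ℤ) + ((0 : ℕ) : ℤ)) = 1 := by
      rw [← sgn_zero K]; congr 1; simp
    rw [es, one_smul]
    refine (st_left D p q (m + 1) a _).trans ?_
    exact congrArg (PC (show m + 1 = 0 + (m + 1) by omega)) (act_chains D m _ y _ ZA hA)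
  · intro n a x CB ZB hB
    refine (FB_apply D p q _ _ _ _).trans ?_
    have es : sgn K (((n + 1 : ℕ) : ℤ) * ((0 : ℕ) : ℤ) + ((n + 1 : ℕ) : ℤ)) =
        sgn K ((n : ℤ) + 1) := by
      congr 1; push_cast; ring
    rw [es]
    refine congrArg (fun w => sgn K ((n : ℤ) + 1) • w) ?_
    refine (st_right D p q (n + 1) _ a).trans ?_
    exact act_chains D n _ x _ ZB hB
  · intro a b
    refine (FB_apply D p q 0 0 a b).trans ?_
    have es : sgn K (((0 : ℕ) : ℤ) * ((0 : ℕ) : ℤ) + ((0 : ℕ) : ℤ)) = 1 := by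
      rw [← sgn_zero K]; congr 1
    rw [es, one_smul]
    exact st_zero D p q a b

variable {p q}
def CT (htw : IsTwistor D p q) (n m : ℕ) : PF n →ₗ[K] PF m →ₗ[K] PF (n + m) :=
  sgn K ((n : ℤ) * m) • cat D htw n m

theorem CT_apply (htw : IsTwistor D p q) (n m : ℕ) (x : PF n) (y : PF m) :
    CT D htw n m x y = sgn K ((n : ℤ) * m) • cat D htw n m x y := rfl

theorem CT_concat (htw : IsTwistor D p q) :
    IsConcatOn (alphaF D p q) (betaF D p q) (starF D p q)
        (fun n m => sgn K ((n : ℤ) * (m : ℤ))) (CT D htw) := by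
  refine ⟨?_, ?_, ?_, ?_⟩
  · intro n m x y
    refine (CT_apply D htw _ _ _ _).trans ?_
    refine congrArg (fun w => sgn K (((n + 1 : ℕ) : ℤ) * ((m + 1 : ℕ) : ℤ)) • w) ?_
    exact congrArg (MF (n + 1 + (m + 1))) (chain_append n m x y)
  · intro m a y
    refine (CT_apply D htw _ _ _ _).trans ?_
    have es : sgn K (((0 : ℕ) : ℤ) * ((m + 1 : ℕ) : ℤ)) = 1 := by
      rw [← sgn_zero K]; congr 1; simp
    rw [es, one_smul]
    rfl
  · intro n a x
    refine (CT_apply D htw _ _ _ _).trans ?_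
    have es : sgn K (((n + 1 : ℕ) : ℤ) * ((0 : ℕ) : ℤ)) = 1 := by
      rw [← sgn_zero K]; congr 1
    rw [es, one_smul]
    rfl
  · intro a b
    refine (CT_apply D htw 0 0 a b).trans ?_
    have es : sgn K (((0 : ℕ) : ℤ) * ((0 : ℕ) : ℤ)) = 1 := by
      rw [← sgn_zero K]; congr 1
    rw [es, one_smul]
    exact st_zero D p q a b

variable (p q)
theorem ee_chain : IsEChain D p q (ee D p q) := by
  refine ⟨rfl, ?_, ?_⟩
  · refine congrArg (MK 2) ?_
    refine Eq.trans ?_ (mul_one (∑ c, t2 (p c) (q c) : TP K H 2))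
    rfl
  · intro n CP ZP h
    show MK (n + 2) (ee D p q (n + 2)) = MK (n + 2)
      ((∑ c, ∑ d : Fin (CP c), chainP K H (n + 2) (Fin.snoc (ZP c d) (q c))) *
        tm n (ee D p q (n + 1)) 1)
    rw [ee_succ]
    refine mk_mul_congr ?_ _
    rw [map_sum, map_sum]
    refine Finset.sum_congr rfl fun c _ => ?_
    refine (mk_tm_congr ((mk_dl D n (p c)).trans (h c).symm) (q c)).trans ?_
    refine congrArg (MK (n + 2)) ?_
    rw [map_sum, LinearMap.sum_apply]
    refine Finset.sum_congr rfl fun d _ => ?_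
    rw [chain_succ]
    simp only [Fin.snoc_castSucc, Fin.snoc_last]

variable {p q}
theorem FS_sharp (htw : IsTwistor D p q) : IsFSharp D p q (ee D p q) (FS D htw) :=
  ⟨fun a => rfl, fun n x => fs_eq D p q n _⟩

theorem FB_assoc (htw : IsTwistor D p q) (n m l : ℕ) (x : PP n) (y : PP m) (z : PP l) :
    sgn K ((n : ℤ) + (m : ℤ)) • FB D p q (n + m) l (sgn K (n : ℤ) • FB D p q n m x y) z =
      PC (nadd_eq n m l)
        (sgn K (n : ℤ) • FB D p q n (m + l) x (sgn K (m : ℤ) • FB D p q m l y z)) := by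
  rw [FB_cup, FB_cup, FB_cup]
  have := FB_cup D p q (n + m) l (sgn K ((n : ℤ) * m) • st D p q n m x y) z
  rw [Nat.cast_add] at this
  rw [this, map_smul, map_smul, map_smul, map_smul, LinearMap.smul_apply, ← st_assoc D htw,
    phc_phc, phc_rfl, smul_smul, smul_smul, ← sgn_add, ← sgn_add]
  congr 2
  push_cast; ring

end Final
end TwAux

/-! ### STATEMENT 11 -/

/-- **The twisted cup product `∪_F` and the algebra morphism `F♯` (Theorem on
`(W_H, ∪_F)`).**  Let `F = Σ_c (p c) ⊗_R (q c)` be a twistor of the Hopf algebroid `H`.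
Then: (i) `W_H = ⊕ₙ H^{⊗_R n}` with the twisted product `x ∪_F y := (−1)^{|x|} F{x, y}`
is a graded associative algebra with unit `1 ∈ R = W_H⁰`; (ii) the assignment
`x₁ ∪ ⋯ ∪ x_n ↦ x₁ ∪_F ⋯ ∪_F x_n` descends to a well-defined `K`-linear map
`F♯ : W_{H_F} → W_H` (here `W_{H_F} = ⊕ₙ H^{⊗_{R_F} n}` carries the product
`x ∪ y = (−1)^{|x||y|} x ⊗_{R_F} y`), and `F♯` is a morphism of graded associative
algebras: `F♯(y ∪ y') = F♯(y) ∪_F F♯(y')`. -/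
theorem twistor_cup_and_FSharp_algebra_morphism
    (K : Type u) [Field K] [CharZero K]
    (H : Type u) [Ring H] [Algebra K H]
    (R : Type u) [Ring R] [Algebra K R]
    (α : R →ₐ[K] H) (β : R →ₗ[K] H)
    (D : HopfAlgebroid K H R α β)
    (C : ℕ) (p q : Fin C → H) (htw : IsTwistor D p q) :
    ∃ (Fbr : ∀ n m : ℕ, PH K H (fun a => α a) (fun a => β a) n →ₗ[K]
          PH K H (fun a => α a) (fun a => β a) m →ₗ[K]
          PH K H (fun a => α a) (fun a => β a) (n + m))
      (cupT : ∀ n m : ℕ, PH K H (alphaF D p q) (betaF D p q) n →ₗ[K]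
          PH K H (alphaF D p q) (betaF D p q) m →ₗ[K]
          PH K H (alphaF D p q) (betaF D p q) (n + m))
      (e : ∀ n : ℕ, TP K H n)
      (Fs : ∀ n : ℕ, PH K H (alphaF D p q) (betaF D p q) n →ₗ[K]
          PH K H (fun a => α a) (fun a => β a) n),
      -- the operadic braces `F{·,·}` of `P_H` applied to `F ∈ P_H(2)`
      IsFBrace D p q Fbr ∧
      -- the product `∪` of `W_{H_F}`
      IsConcatOn (alphaF D p q) (betaF D p q) (starF D p q)
        (fun n m => sgn K ((n : ℤ) * (m : ℤ))) cupT ∧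
      -- `F♯` is induced by left multiplication by `E_n = F_{1∧⋯∧n−1,n} ⋯ F_{1,2}`
      IsEChain D p q e ∧ IsFSharp D p q e Fs ∧
      -- (i) `(W_H, ∪_F)` is a graded associative algebra, `x ∪_F y = (−1)^{|x|} F{x,y}`
      (∀ (n m l : ℕ) (x : PH K H (fun a => α a) (fun a => β a) n)
          (y : PH K H (fun a => α a) (fun a => β a) m)
          (z : PH K H (fun a => α a) (fun a => β a) l),
        sgn K ((n : ℤ) + (m : ℤ)) • Fbr (n + m) l (sgn K (n : ℤ) • Fbr n m x y) z =
          phCast K H (fun a => α a) (fun a => β a) (by omega)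
            (sgn K (n : ℤ) • Fbr n (m + l) x (sgn K (m : ℤ) • Fbr m l y z))) ∧
      (∀ (m : ℕ) (u : PH K H (fun a => α a) (fun a => β a) m),
        Fbr 0 m (1 : R) u = phCast K H (fun a => α a) (fun a => β a) (by omega) u) ∧
      (∀ (n : ℕ) (x : PH K H (fun a => α a) (fun a => β a) n),
        sgn K (n : ℤ) • Fbr n 0 x (1 : R) = x) ∧
      -- (ii) `F♯(y ∪ y') = F♯(y) ∪_F F♯(y')`
      (∀ (n m : ℕ) (y : PH K H (alphaF D p q) (betaF D p q) n)
          (y' : PH K H (alphaF D p q) (betaF D p q) m),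
        Fs (n + m) (cupT n m y y') = sgn K (n : ℤ) • Fbr n m (Fs n y) (Fs m y')) := by
  refine ⟨TwAux.FB D p q, TwAux.CT D htw, TwAux.ee D p q, TwAux.FS D htw,
    TwAux.FB_brace D p q, TwAux.CT_concat D htw, TwAux.ee_chain D p q, TwAux.FS_sharp D htw,
    TwAux.FB_assoc D htw, ?_, ?_, ?_⟩
  · intro m u
    refine (TwAux.FB_apply D p q 0 m _ u).trans ?_
    have es : sgn K (((0 : ℕ) : ℤ) * (m : ℤ) + ((0 : ℕ) : ℤ)) = 1 := by
      rw [← TwAux.sgn_zero K]; congr 1; simp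
    rw [es, one_smul]
    exact TwAux.st_one_left D htw m u
  · intro n x
    refine (TwAux.FB_cup D p q n 0 x _).trans ?_
    have es : sgn K ((n : ℤ) * ((0 : ℕ) : ℤ)) = 1 := by
      rw [← TwAux.sgn_zero K]; congr 1
    rw [es, one_smul]
    exact TwAux.st_one_right D htw n x
  · intro n m y y'
    rw [TwAux.FB_cup, TwAux.CT_apply, map_smul, TwAux.FS_cat]
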